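/- arXiv:2006.00507 — 7 statements merged into one kernel-verified Lean document; each statement's English description precedes it below -/
import Mathlib

section
/- For all integers n ≥ 1 and 1 ≤ k ≤ n, the number of down-up alternating permutations of [n] whose first entry is k equals the Entringer number E_{n,k}; that is, #DU_{n,k} = E_{n,k}. -/
/-- `w` is a down-up alternating word: `w 0 > w 1 < w 2 > w 3 < ⋯` (0-indexed). -/
def DownUpWord {α : Type*} [LT α] (w : List α) : Prop :=
  ∀ i : ℕ, ∀ h : i + 1 < w.length,
    (i % 2 = 0 → w.get ⟨i + 1, h⟩ < w.get ⟨i, Nat.lt_of_succ_lt h⟩) ∧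
    (i % 2 = 1 → w.get ⟨i, Nat.lt_of_succ_lt h⟩ < w.get ⟨i + 1, h⟩)

namespace Entringer

theorem perm_range'_one_iff {l : List ℕ} {n : ℕ} :
    l.Perm (List.range' 1 n) ↔ l.Nodup ∧ ∀ x, x ∈ l ↔ 1 ≤ x ∧ x ≤ n := by
  constructor
  · intro h
    refine ⟨h.nodup_iff.2 List.nodup_range', fun x => ?_⟩
    rw [h.mem_iff, List.mem_range'_1]
    omega
  · rintro ⟨hd, hm⟩
    rw [List.perm_ext_iff_of_nodup hd List.nodup_range']
    intro x
    rw [hm, List.mem_range'_1]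
    omega

/-- Prepending a letter to an order-reversed word gives a down-up word exactly when the
original word is down-up and the new first letter is larger than the next one. -/
theorem downUpWord_cons_map_iff {α β : Type*} [LinearOrder α] [LinearOrder β]
    {f : α → β} {l : List α} (hf : StrictAntiOn f {x | x ∈ l}) (b : β) :
    DownUpWord (b :: l.map f) ↔ DownUpWord l ∧ ∀ a ∈ l.head?, f a < b := by
  have hlt : ∀ (i j : ℕ) (hi : i < l.length) (hj : j < l.length),
      f l[i] < f l[j] ↔ l[j] < l[i] := fun i j hi hj =>
    hf.lt_iff_gt (List.getElem_mem hi) (List.getElem_mem hj)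
  constructor
  · intro h
    refine ⟨fun i hi => ?_, fun a ha => ?_⟩
    · have h' := h (i + 1) (by simpa using hi)
      simp only [List.get_eq_getElem, List.getElem_cons_succ, List.getElem_map, hlt] at h' ⊢
      exact ⟨fun hp => h'.2 (by omega), fun hp => h'.1 (by omega)⟩
    · cases l with
      | nil => simp at ha
      | cons c t =>
        obtain rfl : c = a := by simpa using ha
        simpa using (h 0 (by simp)).1 rfl
  · rintro ⟨h, hb⟩ i hi
    cases i with
    | zero =>
      cases l with
      | nil => simp at hi
      | cons c t => simpa using hb c (by simp)
    | succ i =>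
      have h' := h i (by simpa using hi)
      simp only [List.get_eq_getElem, List.getElem_cons_succ, List.getElem_map, hlt] at h' ⊢
      exact ⟨fun hp => h'.2 (by omega), fun hp => h'.1 (by omega)⟩

/-- The down-up permutations of `[n]` with first entry `k`. -/
def headEq (n k : ℕ) : Set (List ℕ) :=
  {l | l.Perm (List.range' 1 n) ∧ DownUpWord l ∧ l.head? = some k}

/-- The down-up permutations of `[n]` with first entry at least `m`
(and the empty word, if `n = 0`). -/
def headGe (n m : ℕ) : Set (List ℕ) :=
  {l | l.Perm (List.range' 1 n) ∧ DownUpWord l ∧ ∀ a ∈ l.head?, m ≤ a}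

theorem finite_setOf_perm {α : Type*} (r : List α) : {l : List α | l.Perm r}.Finite :=
  (List.finite_toSet r.permutations).subset fun _ h => List.mem_permutations.2 h

theorem finite_headEq (n k : ℕ) : (headEq n k).Finite :=
  (finite_setOf_perm _).subset fun _ h => h.1

theorem finite_headGe (n m : ℕ) : (headGe n m).Finite :=
  (finite_setOf_perm _).subset fun _ h => h.1

theorem exists_head?_eq_some {l : List ℕ} {n : ℕ} (hn : 1 ≤ n)
    (hl : l.Perm (List.range' 1 n)) : ∃ a, l.head? = some a ∧ 1 ≤ a ∧ a ≤ n := by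
  cases l with
  | nil =>
    have := hl.length_eq
    simp only [List.length_nil, List.length_range'] at this
    omega
  | cons a t => exact ⟨a, rfl, ((perm_range'_one_iff.1 hl).2 a).1 (by simp)⟩

theorem ncard_headGe {n : ℕ} (hn : 1 ≤ n) (m : ℕ) :
    (headGe n m).ncard = (headEq n m).ncard + (headGe n (m + 1)).ncard := by
  rw [← Set.ncard_union_eq _ (finite_headEq n m) (finite_headGe n (m + 1))]
  · congr 1
    ext l
    simp only [headGe, headEq, Set.mem_union, Set.mem_ofPred_eq]
    constructor
    · rintro ⟨hp, hd, h⟩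
      obtain ⟨a, ha, -⟩ := exists_head?_eq_some hn hp
      have := h a ha
      rcases this.eq_or_lt with rfl | hlt
      · exact Or.inl ⟨hp, hd, ha⟩
      · exact Or.inr ⟨hp, hd, by simpa [ha] using hlt⟩
    · rintro (⟨hp, hd, h⟩ | ⟨hp, hd, h⟩)
      · exact ⟨hp, hd, by simp [h]⟩
      · exact ⟨hp, hd, fun a ha => (Nat.le_succ m).trans (h a ha)⟩
  · rw [Set.disjoint_left]
    rintro l ⟨-, -, h⟩ ⟨-, -, h'⟩
    exact absurd (h' m h) (by omega)

theorem headGe_eq_empty {n m : ℕ} (hn : 1 ≤ n) (h : n < m) : headGe n m = ∅ := by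
  rw [Set.eq_empty_iff_forall_notMem]
  rintro l ⟨hp, -, hm⟩
  obtain ⟨a, ha, -, han⟩ := exists_head?_eq_some hn hp
  exact absurd (hm a ha) (by omega)

/-- The order-reversing bijection from `[n]` to `[n + 1] \ {k}`. -/
def skip (n k y : ℕ) : ℕ := if n + 1 - y < k then n + 1 - y else n + 2 - y

/-- The inverse of `skip n k`. -/
def unskip (n k x : ℕ) : ℕ := if x < k then n + 1 - x else n + 2 - x

theorem strictAntiOn_skip (n k : ℕ) : StrictAntiOn (skip n k) (Set.Icc 1 n) := by
  rintro a ⟨-, ha⟩ b ⟨-, hb⟩ hab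
  unfold skip
  split_ifs <;> omega

theorem skip_mem_Icc {n k y : ℕ} (hy : y ∈ Set.Icc 1 n) :
    skip n k y ∈ Set.Icc 1 (n + 1) ∧ skip n k y ≠ k := by
  simp only [Set.mem_Icc] at hy ⊢
  unfold skip
  split_ifs <;> omega

theorem unskip_mem_Icc {n k x : ℕ} (hk : 1 ≤ k) (hkn : k ≤ n + 1)
    (hx : x ∈ Set.Icc 1 (n + 1)) (hxk : x ≠ k) : unskip n k x ∈ Set.Icc 1 n := by
  simp only [Set.mem_Icc] at hx ⊢
  unfold unskip
  split_ifs <;> omega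

theorem unskip_skip {n k y : ℕ} (hy : y ∈ Set.Icc 1 n) : unskip n k (skip n k y) = y := by
  simp only [Set.mem_Icc] at hy
  unfold skip unskip
  split_ifs <;> omega

theorem skip_unskip {n k x : ℕ} (hx : x ∈ Set.Icc 1 (n + 1)) (hxk : x ≠ k) :
    skip n k (unskip n k x) = x := by
  simp only [Set.mem_Icc] at hx
  unfold skip unskip
  split_ifs <;> omega

theorem map_unskip_map_skip {n k : ℕ} {l : List ℕ} (hl : ∀ x ∈ l, x ∈ Set.Icc 1 n) :
    (l.map (skip n k)).map (unskip n k) = l := by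
  rw [List.map_map]
  exact (List.map_congr_left fun x hx => unskip_skip (hl x hx)).trans (List.map_id _)

theorem perm_cons_map_skip {n k : ℕ} (hk : 1 ≤ k) (hkn : k ≤ n + 1) :
    (k :: (List.range' 1 n).map (skip n k)).Perm (List.range' 1 (n + 1)) := by
  have hmem : ∀ x, x ∈ List.range' 1 n ↔ x ∈ Set.Icc 1 n :=
    (perm_range'_one_iff.1 (List.Perm.refl (List.range' 1 n))).2
  rw [perm_range'_one_iff, List.nodup_cons]
  refine ⟨⟨fun h => ?_, ?_⟩, fun x => ?_⟩
  · obtain ⟨y, hy, hyk⟩ := List.mem_map.1 h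
    exact (skip_mem_Icc ((hmem y).1 hy)).2 hyk
  · refine List.Nodup.map_on (fun x hx y hy h => ?_) List.nodup_range'
    rw [← unskip_skip (k := k) ((hmem x).1 hx), h, unskip_skip ((hmem y).1 hy)]
  · rw [List.mem_cons, List.mem_map]
    constructor
    · rintro (rfl | ⟨y, hy, rfl⟩)
      · exact ⟨hk, hkn⟩
      · exact (skip_mem_Icc ((hmem y).1 hy)).1
    · intro hx
      by_cases hxk : x = k
      · exact Or.inl hxk
      · exact Or.inr ⟨unskip n k x, (hmem _).2 (unskip_mem_Icc hk hkn hx hxk),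
          skip_unskip hx hxk⟩

theorem cons_map_skip_mem_headEq_iff {n k : ℕ} (hk : 1 ≤ k) (hkn : k ≤ n + 1) {l : List ℕ}
    (hl : ∀ x ∈ l, x ∈ Set.Icc 1 n) :
    k :: l.map (skip n k) ∈ headEq (n + 1) k ↔ l ∈ headGe n (n + 2 - k) := by
  have hanti : StrictAntiOn (skip n k) {x | x ∈ l} := (strictAntiOn_skip n k).mono hl
  have hperm : (k :: l.map (skip n k)).Perm (List.range' 1 (n + 1)) ↔
      l.Perm (List.range' 1 n) := by
    rw [← (perm_cons_map_skip hk hkn).congr_right, List.perm_cons]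
    refine ⟨fun h => ?_, fun h => h.map _⟩
    have h' := h.map (unskip n k)
    rwa [map_unskip_map_skip hl, map_unskip_map_skip fun x hx =>
      ((perm_range'_one_iff.1 (List.Perm.refl (List.range' 1 n))).2 x).1 hx] at h'
  have hhead : (∀ a ∈ l.head?, skip n k a < k) ↔ ∀ a ∈ l.head?, n + 2 - k ≤ a := by
    refine forall₂_congr fun a ha => ?_
    have := hl a (List.mem_of_mem_head? ha)
    simp only [Set.mem_Icc] at this
    unfold skip
    split_ifs <;> omega
  simp only [headEq, headGe, Set.mem_ofPred_eq, hperm, downUpWord_cons_map_iff hanti, hhead,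
    List.head?_cons, and_true]

theorem ncard_headEq_succ {n k : ℕ} (hk : 1 ≤ k) (hkn : k ≤ n + 1) :
    (headEq (n + 1) k).ncard = (headGe n (n + 2 - k)).ncard := by
  have hIcc : ∀ l ∈ headGe n (n + 2 - k), ∀ x ∈ l, x ∈ Set.Icc 1 n := fun l hl x hx =>
    ((perm_range'_one_iff.1 hl.1).2 x).1 hx
  have himage : headEq (n + 1) k =
      (fun l => k :: l.map (skip n k)) '' headGe n (n + 2 - k) := by
    ext w
    constructor
    · intro hw
      obtain ⟨hnd, hm⟩ := perm_range'_one_iff.1 hw.1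
      obtain ⟨t, rfl⟩ := List.head?_eq_some_iff.1 hw.2.2
      have ht : ∀ x ∈ t, x ∈ Set.Icc 1 (n + 1) ∧ x ≠ k := fun x hx =>
        ⟨(hm x).1 (by simp [hx]), fun h => (List.nodup_cons.1 hnd).1 (h ▸ hx)⟩
      have hinv : (t.map (unskip n k)).map (skip n k) = t := by
        rw [List.map_map]
        exact (List.map_congr_left fun x hx => skip_unskip (ht x hx).1 (ht x hx).2).trans (List.map_id _)
      refine ⟨t.map (unskip n k), ?_, by simp only [hinv]⟩
      rw [← cons_map_skip_mem_headEq_iff hk hkn, hinv]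
      · exact hw
      · intro y hy
        obtain ⟨x, hx, rfl⟩ := List.mem_map.1 hy
        exact unskip_mem_Icc hk hkn (ht x hx).1 (ht x hx).2
    · rintro ⟨l, hl, rfl⟩
      exact (cons_map_skip_mem_headEq_iff hk hkn (hIcc l hl)).2 hl
  rw [himage, Set.InjOn.ncard_image]
  intro l hl l' hl' h
  have h' : l.map (skip n k) = l'.map (skip n k) := (List.cons.inj h).2
  rw [← map_unskip_map_skip (k := k) (hIcc l hl), h', map_unskip_map_skip (hIcc l' hl')]

theorem headEq_one_one : headEq 1 1 = {[1]} := by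
  ext l
  simp only [headEq, List.range'_one, List.perm_singleton, Set.mem_ofPred_eq,
    Set.mem_singleton_iff]
  refine ⟨fun h => h.1, ?_⟩
  rintro rfl
  exact ⟨rfl, fun i hi => by simp at hi, rfl⟩

end Entringer

/-- **Entringer's theorem.** For `1 ≤ k ≤ n`, the number of down-up alternating
permutations of `[n]` with first entry `k` equals the Entringer number `E n k`,
where `E` is determined by `E 1 1 = 1`, `E n 1 = 0` for `n ≥ 2`, and
`E n k = E n (k-1) + E (n-1) (n+1-k)` for `n ≥ k ≥ 2`. -/
theorem downUp_first_entry_count_eq_entringer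
    (E : ℕ → ℕ → ℕ)
    (hE11 : E 1 1 = 1)
    (hEn1 : ∀ n : ℕ, 2 ≤ n → E n 1 = 0)
    (hErec : ∀ n k : ℕ, 2 ≤ k → k ≤ n → E n k = E n (k - 1) + E (n - 1) (n + 1 - k))
    (n k : ℕ) (hn : 1 ≤ n) (hk : 1 ≤ k) (hkn : k ≤ n) :
    Nat.card {l : List ℕ // l.Perm (List.range' 1 n) ∧ DownUpWord l ∧ l.head? = some k}
      = E n k := by
  change (Entringer.headEq n k).ncard = E n k
  induction n, hn using Nat.le_induction generalizing k with
  | base =>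
    obtain rfl : k = 1 := by omega
    rw [Entringer.headEq_one_one, Set.ncard_singleton, hE11]
  | succ n hn ih =>
    induction k, hk using Nat.le_induction with
    | base =>
      rw [Entringer.ncard_headEq_succ le_rfl (by omega),
        Entringer.headGe_eq_empty hn (by omega), Set.ncard_empty, hEn1 _ (by omega)]
    | succ k hk ihk =>
      rw [Entringer.ncard_headEq_succ (by omega) hkn, Entringer.ncard_headGe hn,
        show n + 2 - (k + 1) + 1 = n + 2 - k by omega,
        ← Entringer.ncard_headEq_succ hk (by omega), ih _ (by omega) (by omega),
        ihk (by omega), hErec (n + 1) (k + 1) (by omega) hkn, Nat.add_comm]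
      rfl
end

section
/- For all integers n ≥ 1 and 1 ≤ k ≤ n, the number of snakes of type B_n whose first entry is k equals the Arnold number S_{n,k}. -/
/-- Signed permutation of `[n]`: the absolute values form a permutation of `1, …, n`. -/
def IsSignedPerm (n : ℕ) (l : List ℤ) : Prop :=
  (l.map Int.natAbs).Perm (List.range' 1 n)

/-- Insert a gap at the absolute value `|k|`, then negate. -/
def negGap (k x : ℤ) : ℤ :=
  if x.natAbs < k.natAbs then -x else if 0 < x then -x - 1 else -x + 1

/-- Down-up signed permutations of `[n]` whose first entry, if any, is at least `b`. -/
def downUpGE (n : ℕ) (b : ℤ) : Set (List ℤ) :=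
  {l | IsSignedPerm n l ∧ DownUpWord l ∧ ∀ m ∈ l.head?, b ≤ m}

/-- Down-up signed permutations of `[n]` with first entry `k`. -/
def downUpHead (n : ℕ) (k : ℤ) : Set (List ℤ) :=
  {l | IsSignedPerm n l ∧ DownUpWord l ∧ l.head? = some k}

theorem negGap_strictAnti (k : ℤ) : StrictAnti (negGap k) := by
  intro x y h
  unfold negGap
  split_ifs <;> omega

theorem natAbs_negGap (k x : ℤ) :
    (negGap k x).natAbs = if x.natAbs < k.natAbs then x.natAbs else x.natAbs + 1 := by
  unfold negGap
  split_ifs <;> omega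

theorem exists_negGap_eq {k x : ℤ} (hk : k ≠ 0) (hx : x.natAbs ≠ k.natAbs) :
    ∃ y, negGap k y = x := by
  by_cases h : x.natAbs < k.natAbs
  · exact ⟨-x, by simp [negGap, h]⟩
  · by_cases h0 : 0 < x
    · refine ⟨-x + 1, ?_⟩
      unfold negGap
      split_ifs <;> omega
    · refine ⟨-x - 1, ?_⟩
      unfold negGap
      split_ifs <;> omega

theorem isSignedPerm_cons_map_negGap {n : ℕ} {k : ℤ} (hk : k ≠ 0) (hkn : k.natAbs ≤ n + 1)
    (l : List ℤ) : IsSignedPerm (n + 1) (k :: l.map (negGap k)) ↔ IsSignedPerm n l := by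
  let u : ℕ → ℕ := fun x => if x < k.natAbs then x else x + 1
  have hu : Function.Injective u := by
    intro x y h
    simp only [u] at h
    split_ifs at h <;> omega
  have hrange : (k.natAbs :: (List.range' 1 n).map u).Perm (List.range' 1 (n + 1)) := by
    rw [List.perm_ext_iff_of_nodup]
    · intro a
      simp only [List.mem_cons, List.mem_map, List.mem_range'_1, u]
      constructor
      · rintro (rfl | ⟨x, hx, rfl⟩)
        · omega
        · split_ifs <;> omega
      · intro ha
        rcases lt_trichotomy a k.natAbs with h | h | h
        · exact Or.inr ⟨a, by omega, by simp [h]⟩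
        · exact Or.inl h
        · refine Or.inr ⟨a - 1, by omega, ?_⟩
          split_ifs <;> omega
    · refine List.nodup_cons.mpr ⟨?_, (List.nodup_range' ..).map hu⟩
      simp only [List.mem_map, u]
      rintro ⟨x, -, hx⟩
      split_ifs at hx <;> omega
    · exact List.nodup_range' ..
  have hmap : (k :: l.map (negGap k)).map Int.natAbs = k.natAbs :: (l.map Int.natAbs).map u := by
    simp [u, natAbs_negGap]
  unfold IsSignedPerm
  rw [hmap]
  constructor
  · intro h
    exact (List.map_perm_map_iff hu).mp ((h.trans hrange.symm).cons_inv)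
  · intro h
    exact ((h.map u).cons _).trans hrange

theorem downUpWord_cons_map {g : ℤ → ℤ} (hg : StrictAnti g) (k : ℤ) (l : List ℤ) :
    DownUpWord (k :: l.map g) ↔ DownUpWord l ∧ ∀ m ∈ l.head?, g m < k := by
  constructor
  · intro h
    refine ⟨fun i hi => ?_, fun m hm => ?_⟩
    · have := h (i + 1) (by simpa using hi)
      simp only [List.get_eq_getElem, List.getElem_cons_succ, List.getElem_map,
        hg.lt_iff_gt] at this
      exact ⟨fun h0 => this.2 (by omega), fun h1 => this.1 (by omega)⟩
    · cases l with
      | nil => simp at hm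
      | cons a t =>
        obtain rfl : a = m := by simpa using hm
        simpa using (h 0 (by simp)).1 rfl
  · rintro ⟨h, hh⟩ i hi
    cases i with
    | zero =>
      cases l with
      | nil => simp at hi
      | cons a t => simpa using hh a
    | succ i =>
      have := h i (by simpa using hi)
      simp only [List.get_eq_getElem, List.getElem_cons_succ, List.getElem_map,
        hg.lt_iff_gt] at this ⊢
      exact ⟨fun h0 => this.2 (by omega), fun h1 => this.1 (by omega)⟩

theorem negGap_lt_iff {k : ℤ} (hk : k ≠ 0) (m : ℤ) :
    negGap k m < k ↔ (if 0 < k then 1 - k else -k) ≤ m := by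
  unfold negGap
  split_ifs <;> omega

theorem downUpHead_succ_eq_image {n : ℕ} {k : ℤ} (hk : k ≠ 0) (hkn : k.natAbs ≤ n + 1) :
    downUpHead (n + 1) k =
      (fun l => k :: l.map (negGap k)) '' downUpGE n (if 0 < k then 1 - k else -k) := by
  have key (l : List ℤ) : k :: l.map (negGap k) ∈ downUpHead (n + 1) k ↔
      l ∈ downUpGE n (if 0 < k then 1 - k else -k) := by
    simp [downUpHead, downUpGE, isSignedPerm_cons_map_negGap hk hkn,
      downUpWord_cons_map (negGap_strictAnti k), negGap_lt_iff hk]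
  ext w
  constructor
  · intro hw
    obtain ⟨t, rfl⟩ : ∃ t, w = k :: t := List.head?_eq_some_iff.mp hw.2.2
    have hnd : ((k :: t).map Int.natAbs).Nodup := hw.1.nodup_iff.mpr (List.nodup_range' ..)
    have ht : t ∈ Set.range (List.map (negGap k)) := by
      rw [Set.range_list_map]
      intro x hx
      refine exists_negGap_eq hk fun h => ?_
      rw [List.map_cons, List.nodup_cons] at hnd
      exact hnd.1 (List.mem_map.mpr ⟨x, hx, h⟩)
    obtain ⟨l, rfl⟩ := ht
    exact ⟨l, (key l).mp hw, rfl⟩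
  · rintro ⟨l, hl, rfl⟩
    exact (key l).mpr hl

theorem encard_downUpHead_succ {n : ℕ} {k : ℤ} (hk : k ≠ 0) (hkn : k.natAbs ≤ n + 1) :
    (downUpHead (n + 1) k).encard = (downUpGE n (if 0 < k then 1 - k else -k)).encard := by
  rw [downUpHead_succ_eq_image hk hkn]
  refine Function.Injective.encard_image (fun a b h => ?_) _
  exact List.map_injective_iff.mpr (negGap_strictAnti k).injective (List.cons.inj h).2

theorem encard_downUpGE_zero (b : ℤ) : (downUpGE 0 b).encard = 1 := by
  rw [Set.encard_eq_one]
  refine ⟨[], ?_⟩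
  ext l
  constructor
  · intro h
    simpa [IsSignedPerm] using h.1
  · rintro rfl
    exact ⟨by simp [IsSignedPerm], fun i h => by simp at h, by simp⟩

theorem IsSignedPerm.exists_head {n : ℕ} {l : List ℤ} (h : IsSignedPerm n l) (hn : 1 ≤ n) :
    ∃ a, l.head? = some a ∧ 1 ≤ a.natAbs ∧ a.natAbs ≤ n := by
  cases l with
  | nil =>
    have := h.length_eq
    simp at this
    omega
  | cons a t =>
    have : a.natAbs ∈ List.range' 1 n := h.subset (by simp)
    rw [List.mem_range'_1] at this
    exact ⟨a, rfl, by omega, by omega⟩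

theorem encard_downUpGE_eq_add {n : ℕ} (hn : 1 ≤ n) (b : ℤ) :
    (downUpGE n b).encard = (downUpGE n (b + 1)).encard + (downUpHead n b).encard := by
  rw [← Set.encard_union_eq]
  · congr 1
    ext l
    constructor
    · intro h
      obtain ⟨a, ha, -⟩ := h.1.exists_head hn
      have hab := h.2.2 a ha
      rcases hab.eq_or_lt with rfl | hlt
      · exact Or.inr ⟨h.1, h.2.1, ha⟩
      · exact Or.inl ⟨h.1, h.2.1, by simpa [ha] using hlt⟩
    · rintro (h | h)
      · exact ⟨h.1, h.2.1, fun m hm => by have := h.2.2 m hm; omega⟩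
      · exact ⟨h.1, h.2.1, by simp [h.2.2]⟩
  · rw [Set.disjoint_left]
    intro l h h'
    have := h.2.2 b h'.2.2
    omega

theorem encard_downUpHead_zero {n : ℕ} (hn : 1 ≤ n) : (downUpHead n 0).encard = 0 := by
  rw [Set.encard_eq_zero, Set.eq_empty_iff_forall_notMem]
  intro l h
  obtain ⟨a, ha, h1, -⟩ := h.1.exists_head hn
  have : a = 0 := by simpa [h.2.2] using ha.symm
  omega

theorem encard_downUpGE_succ_self {n : ℕ} (hn : 1 ≤ n) :
    (downUpGE n (n + 1)).encard = 0 := by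
  rw [Set.encard_eq_zero, Set.eq_empty_iff_forall_notMem]
  intro l h
  obtain ⟨a, ha, -, h2⟩ := h.1.exists_head hn
  have := h.2.2 a ha
  omega

theorem encard_downUpHead_eq_arnold
    (S : ℕ → ℤ → ℕ)
    (hS11 : S 1 1 = 1) (hS1m1 : S 1 (-1) = 1)
    (hSnn : ∀ n : ℕ, 2 ≤ n → S n (-(n : ℤ)) = 0)
    (hSpos : ∀ (n : ℕ) (k : ℤ), 1 < k → k ≤ (n : ℤ) →
      S n k = S n (k - 1) + S (n - 1) (-k + 1))
    (hSone : ∀ n : ℕ, 1 < n → S n 1 = S n (-1))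
    (hSneg : ∀ (n : ℕ) (k : ℤ), -(n : ℤ) < k → k ≤ -1 →
      S n k = S n (k - 1) + S (n - 1) (-k))
    (n : ℕ) (hn : 1 ≤ n) :
    ∀ k : ℤ, k ≠ 0 → k.natAbs ≤ n → (downUpHead n k).encard = S n k := by
  induction n, hn using Nat.le_induction with
  | base =>
    intro k hk hk1
    rw [encard_downUpHead_succ hk hk1, encard_downUpGE_zero]
    obtain rfl | rfl : k = 1 ∨ k = -1 := by omega
    · simp [hS11]
    · simp [hS1m1]
  | succ n hn ih =>
    have hneg (j : ℕ) (hj : j ≤ n) :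
        (downUpGE n (n + 1 - j)).encard = S (n + 1) (-(n + 1 - j)) := by
      induction j with
      | zero =>
        have := hSnn (n + 1) (by omega)
        rw [Nat.cast_succ] at this
        rw [Nat.cast_zero, sub_zero, encard_downUpGE_succ_self hn, this, Nat.cast_zero]
      | succ j ihj =>
        have hrec := hSneg (n + 1) (-(n + 1 - (j + 1 : ℕ))) (by push_cast; omega)
          (by push_cast; omega)
        rw [encard_downUpGE_eq_add hn, hrec, ih _ (by omega) (by omega)]
        have e1 : (n + 1 - (j + 1 : ℕ) + 1 : ℤ) = n + 1 - j := by push_cast; ring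
        have e2 : (-(n + 1 - (j + 1 : ℕ)) - 1 : ℤ) = -(n + 1 - j) := by push_cast; ring
        rw [e1, e2, ihj (by omega), neg_neg, Nat.add_sub_cancel]
        push_cast
        rfl
    have hpos (j : ℕ) (hj : j ≤ n) : (downUpGE n (-j)).encard = S (n + 1) (j + 1) := by
      induction j with
      | zero =>
        have h1 := hneg n le_rfl
        rw [add_sub_cancel_left] at h1
        have h2 := encard_downUpGE_eq_add hn 0
        rw [encard_downUpHead_zero hn, add_zero, zero_add, h1, ← hSone (n + 1) (by omega)] at h2
        simpa using h2
      | succ j ihj =>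
        have hrec := hSpos (n + 1) ((j + 1 : ℕ) + 1) (by push_cast; omega)
          (by push_cast; omega)
        rw [encard_downUpGE_eq_add hn, hrec, ih _ (by omega) (by omega)]
        have e1 : (-(j + 1 : ℕ) + 1 : ℤ) = -j := by push_cast; ring
        have e2 : (-((j + 1 : ℕ) + 1) + 1 : ℤ) = -(j + 1 : ℕ) := by ring
        have e3 : ((j + 1 : ℕ) + 1 - 1 : ℤ) = j + 1 := by push_cast; ring
        rw [e1, e2, e3, ihj (by omega), Nat.add_sub_cancel]
        push_cast
        rfl
    intro k hk hkn
    rw [encard_downUpHead_succ hk hkn]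
    split_ifs with h
    · obtain ⟨j, rfl⟩ : ∃ j : ℕ, k = j + 1 := ⟨(k - 1).toNat, by omega⟩
      rw [← hpos j (by omega)]
      congr 2
      ring
    · obtain ⟨j, hj, rfl⟩ : ∃ j : ℕ, j ≤ n ∧ k = -(n + 1 - j) :=
        ⟨(n + 1 + k).toNat, by omega, by omega⟩
      rw [← hneg j hj, neg_neg]

/-- **Arnold's theorem (positive part).** For `1 ≤ k ≤ n`, the number of snakes of
type `B_n` (down-up alternating signed permutations with positive first entry)
whose first entry is `k` equals the Arnold number `S n k`. -/
theorem snake_first_entry_count_eq_arnold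
    (S : ℕ → ℤ → ℕ)
    (hS11 : S 1 1 = 1) (hS1m1 : S 1 (-1) = 1)
    (hSnn : ∀ n : ℕ, 2 ≤ n → S n (-(n : ℤ)) = 0)
    (hSpos : ∀ (n : ℕ) (k : ℤ), 1 < k → k ≤ (n : ℤ) →
      S n k = S n (k - 1) + S (n - 1) (-k + 1))
    (hSone : ∀ n : ℕ, 1 < n → S n 1 = S n (-1))
    (hSneg : ∀ (n : ℕ) (k : ℤ), -(n : ℤ) < k → k ≤ -1 →
      S n k = S n (k - 1) + S (n - 1) (-k))
    (n : ℕ) (k : ℤ) (hn : 1 ≤ n) (hk : 1 ≤ k) (hkn : k ≤ (n : ℤ)) :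
    Nat.card {l : List ℤ // IsSignedPerm n l ∧ DownUpWord l ∧ l.head? = some k}
      = S n k := by
  have h := encard_downUpHead_eq_arnold S hS11 hS1m1 hSnn hSpos hSone hSneg n hn k
    (by omega) (by omega)
  change Nat.card (downUpHead n k) = S n k
  rw [Nat.card_coe_set_eq, Set.ncard_def, h]
  rfl
end

section
/- For all integers n ≥ 1 and -n ≤ k ≤ -1, the number of down-up alternating permutations of type B_n whose first entry is k equals the Arnold number S_{n,k}. -/
/-- The strictly increasing map `ℤ → ℤ` whose image omits exactly `m` and `-m` (for `m ≥ 1`). -/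
def skipAbs (m : ℕ) (y : ℤ) : ℤ :=
  if (m : ℤ) ≤ y then y + 1 else if y ≤ -(m : ℤ) then y - 1 else y

/-- The left inverse of `skipAbs m`, obtained by closing the gaps at `m` and `-m`. -/
def closeAbs (m : ℕ) (x : ℤ) : ℤ :=
  if (m : ℤ) < x then x - 1 else if x < -(m : ℤ) then x + 1 else x

/-- The increasing map `ℕ → ℕ` whose image omits exactly `m`. -/
def skipNat (m : ℕ) (a : ℕ) : ℕ :=
  if m ≤ a then a + 1 else a

theorem skipAbs_strictMono (m : ℕ) : StrictMono (skipAbs m) := by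
  intro a b hab
  unfold skipAbs
  split_ifs <;> omega

theorem skipNat_injective (m : ℕ) : Function.Injective (skipNat m) := by
  intro a b hab
  unfold skipNat at hab
  split_ifs at hab <;> omega

theorem natAbs_skipAbs {m : ℕ} (hm : 1 ≤ m) (y : ℤ) :
    (skipAbs m y).natAbs = skipNat m y.natAbs := by
  unfold skipAbs skipNat
  split_ifs <;> omega

theorem skipAbs_closeAbs {m : ℕ} (hm : 1 ≤ m) {x : ℤ} (hx : x.natAbs ≠ m) :
    skipAbs m (closeAbs m x) = x := by
  unfold skipAbs closeAbs
  split_ifs <;> omega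

theorem neg_lt_skipAbs_iff_of_neg {k : ℤ} (hk : k < 0) (y : ℤ) :
    -k < skipAbs k.natAbs y ↔ -k ≤ y := by
  unfold skipAbs
  split_ifs <;> omega

theorem neg_lt_skipAbs_iff_of_pos {k : ℤ} (hk : 0 < k) (y : ℤ) :
    -k < skipAbs k.natAbs y ↔ -k + 1 ≤ y := by
  unfold skipAbs
  split_ifs <;> omega

theorem cons_map_skipNat_range'_perm {m n : ℕ} (hm : 1 ≤ m) (hmn : m ≤ n + 1) :
    (m :: (List.range' 1 n).map (skipNat m)).Perm (List.range' 1 (n + 1)) := by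
  rw [List.perm_ext_iff_of_nodup]
  · intro a
    simp only [List.mem_cons, List.mem_map, List.mem_range'_1]
    constructor
    · rintro (rfl | ⟨b, hb, rfl⟩)
      · omega
      · unfold skipNat
        split_ifs <;> omega
    · intro ha
      rcases lt_trichotomy a m with h | h | h
      · exact Or.inr ⟨a, by omega, by unfold skipNat; split_ifs <;> omega⟩
      · exact Or.inl h
      · exact Or.inr ⟨a - 1, by omega, by unfold skipNat; split_ifs <;> omega⟩
  · rw [List.nodup_cons]
    refine ⟨?_, (List.nodup_range' (step := 1)).map (skipNat_injective m)⟩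
    simp only [List.mem_map, not_exists, not_and]
    intro b _
    unfold skipNat
    split_ifs <;> omega
  · exact List.nodup_range'

theorem cons_map_skipNat_perm_range'_iff {m n : ℕ} (hm : 1 ≤ m) (hmn : m ≤ n + 1) (l : List ℕ) :
    (m :: l.map (skipNat m)).Perm (List.range' 1 (n + 1)) ↔ l.Perm (List.range' 1 n) := by
  have h := cons_map_skipNat_range'_perm hm hmn
  rw [← h.congr_right, List.perm_cons, List.map_perm_map_iff (skipNat_injective m)]

/-- Prepend `k` to `w`, after renumbering `w` to avoid `± k` and negating it. -/
def insertHead (k : ℤ) (w : List ℤ) : List ℤ :=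
  k :: w.map fun y => -skipAbs k.natAbs y

theorem insertHead_injective (k : ℤ) : Function.Injective (insertHead k) := by
  intro a b hab
  have hinj : Function.Injective fun y => -skipAbs k.natAbs y :=
    neg_injective.comp (skipAbs_strictMono k.natAbs).injective
  exact hinj.list_map (List.cons.inj hab).2

theorem isSignedPerm_insertHead_iff {n : ℕ} {k : ℤ} (hk : k ≠ 0) (hkn : k.natAbs ≤ n + 1)
    (w : List ℤ) : IsSignedPerm (n + 1) (insertHead k w) ↔ IsSignedPerm n w := by
  have h : (insertHead k w).map Int.natAbs
      = k.natAbs :: (w.map Int.natAbs).map (skipNat k.natAbs) := by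
    simp [insertHead, natAbs_skipAbs (m := k.natAbs) (by omega)]
  unfold IsSignedPerm
  rw [h, cons_map_skipNat_perm_range'_iff (by omega) hkn]

theorem downUpWord_insertHead_iff (k : ℤ) (w : List ℤ) :
    DownUpWord (insertHead k w) ↔
      DownUpWord w ∧ ∀ h ∈ w.head?, -k < skipAbs k.natAbs h := by
  have hmono := skipAbs_strictMono k.natAbs
  constructor
  · intro H
    refine ⟨fun i hi => ?_, ?_⟩
    · have := H (i + 1) (by simpa [insertHead] using hi)
      simp only [insertHead, List.get_eq_getElem, List.getElem_cons_succ, List.getElem_map,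
        neg_lt_neg_iff, hmono.lt_iff_lt] at this
      exact ⟨fun h => this.2 (by omega), fun h => this.1 (by omega)⟩
    · rcases w with _ | ⟨a, t⟩
      · simp
      · have := (H 0 (by simp [insertHead])).1 rfl
        simp only [insertHead, List.get_eq_getElem, List.getElem_cons_succ, List.map_cons,
          List.getElem_cons_zero] at this
        simp only [List.head?_cons, Option.mem_some_iff, forall_eq']
        omega
  · rintro ⟨H, H0⟩ i hi
    rcases i with _ | i
    · rcases w with _ | ⟨a, t⟩
      · simp [insertHead] at hi
      · have := H0 a rfl
        simp only [insertHead, List.get_eq_getElem, List.getElem_cons_succ, List.map_cons,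
          List.getElem_cons_zero]
        omega
    · have := H i (by simpa [insertHead] using hi)
      simp only [insertHead, List.get_eq_getElem, List.getElem_cons_succ, List.getElem_map,
        neg_lt_neg_iff, hmono.lt_iff_lt]
      exact ⟨fun h => this.2 (by omega), fun h => this.1 (by omega)⟩

theorem IsSignedPerm.exists_insertHead {n : ℕ} {k : ℤ} (hk : k ≠ 0) {t : List ℤ}
    (h : IsSignedPerm n (k :: t)) : ∃ w, insertHead k w = k :: t := by
  have hnd : ((k :: t).map Int.natAbs).Nodup := h.nodup_iff.2 List.nodup_range'
  rw [List.map_cons, List.nodup_cons] at hnd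
  refine ⟨t.map fun x => closeAbs k.natAbs (-x), ?_⟩
  rw [insertHead, List.map_map]
  congr 1
  conv_rhs => rw [← List.map_id t]
  refine List.map_congr_left fun x hx => ?_
  have hne : (-x).natAbs ≠ k.natAbs := by
    rw [Int.natAbs_neg]
    exact fun he => hnd.1 (he ▸ List.mem_map_of_mem hx)
  simp [skipAbs_closeAbs (m := k.natAbs) (by omega) hne]

/-- The down-up signed permutations of `[n]` with first entry `k`. -/
def downUpHeadEq (n : ℕ) (k : ℤ) : Set (List ℤ) :=
  {l | IsSignedPerm n l ∧ DownUpWord l ∧ l.head? = some k}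

/-- The down-up signed permutations of `[n]` with first entry, if any, at least `j`. -/
def downUpHeadGe (n : ℕ) (j : ℤ) : Set (List ℤ) :=
  {l | IsSignedPerm n l ∧ DownUpWord l ∧ ∀ h ∈ l.head?, j ≤ h}

theorem IsSignedPerm.natAbs_mem_Icc {n : ℕ} {l : List ℤ} (h : IsSignedPerm n l) {x : ℤ}
    (hx : x ∈ l) : x.natAbs ∈ Set.Icc 1 n := by
  have := h.mem_iff.1 (List.mem_map_of_mem hx)
  rw [List.mem_range'_1] at this
  exact ⟨this.1, by omega⟩

theorem setOf_isSignedPerm_finite (n : ℕ) : {l : List ℤ | IsSignedPerm n l}.Finite := by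
  refine ((List.finite_length_eq (Set.Icc (-(n : ℤ)) n) n).image (List.map (↑))).subset ?_
  intro l hl
  have hlen : l.length = n := by simpa using List.Perm.length_eq hl
  have hmem : ∀ x ∈ l, x ∈ Set.Icc (-(n : ℤ)) n := fun x hx => by
    have := (IsSignedPerm.natAbs_mem_Icc hl hx).2
    constructor <;> omega
  lift l to List (Set.Icc (-(n : ℤ)) n) using hmem
  exact ⟨l, by simpa using hlen, rfl⟩

theorem downUpHeadGe_finite (n : ℕ) (j : ℤ) : (downUpHeadGe n j).Finite :=
  (setOf_isSignedPerm_finite n).subset fun _ h => h.1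

theorem downUpHeadEq_finite (n : ℕ) (k : ℤ) : (downUpHeadEq n k).Finite :=
  (setOf_isSignedPerm_finite n).subset fun _ h => h.1

theorem ncard_downUpHeadGe_eq_add {n : ℕ} (hn : 1 ≤ n) (j : ℤ) :
    (downUpHeadGe n j).ncard = (downUpHeadGe n (j + 1)).ncard + (downUpHeadEq n j).ncard := by
  rw [← Set.ncard_union_eq _ (downUpHeadGe_finite _ _) (downUpHeadEq_finite _ _)]
  · congr 1
    ext l
    rcases l with _ | ⟨a, t⟩
    · have : ¬ IsSignedPerm n [] := fun h => by
        have := h.length_eq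
        simp at this
        omega
      simp [downUpHeadGe, downUpHeadEq, this]
    · simp only [downUpHeadGe, downUpHeadEq, Set.mem_union, Set.mem_ofPred_eq, List.head?_cons,
        Option.mem_some_iff, forall_eq', Option.some.injEq, ← and_or_left]
      have : j ≤ a ↔ j + 1 ≤ a ∨ a = j := by omega
      rw [this]
  · rw [Set.disjoint_left]
    rintro l ⟨_, _, h⟩ ⟨_, _, h'⟩
    have := h j h'
    omega

theorem downUpHeadEq_succ_eq_image {n : ℕ} {k : ℤ} (hk : k ≠ 0) (hkn : k.natAbs ≤ n + 1) :
    downUpHeadEq (n + 1) k = insertHead k ''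
      {w | IsSignedPerm n w ∧ DownUpWord w ∧ ∀ h ∈ w.head?, -k < skipAbs k.natAbs h} := by
  ext l
  constructor
  · rintro ⟨hp, hd, hh⟩
    rcases l with _ | ⟨a, t⟩
    · simp at hh
    · obtain rfl : a = k := by simpa using hh
      obtain ⟨w, hw⟩ := hp.exists_insertHead hk
      rw [← hw] at hp hd
      exact ⟨w, ⟨(isSignedPerm_insertHead_iff hk hkn w).1 hp,
        (downUpWord_insertHead_iff _ w).1 hd⟩, hw⟩
  · rintro ⟨w, ⟨hp, hd⟩, rfl⟩
    exact ⟨(isSignedPerm_insertHead_iff hk hkn w).2 hp,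
      (downUpWord_insertHead_iff k w).2 hd, rfl⟩

theorem ncard_downUpHeadEq_succ_of_neg {n : ℕ} {k : ℤ} (hk : k < 0) (hkn : -(n + 1 : ℤ) ≤ k) :
    (downUpHeadEq (n + 1) k).ncard = (downUpHeadGe n (-k)).ncard := by
  rw [downUpHeadEq_succ_eq_image hk.ne (by omega),
    Set.ncard_image_of_injective _ (insertHead_injective k)]
  simp only [neg_lt_skipAbs_iff_of_neg hk, downUpHeadGe]

theorem ncard_downUpHeadEq_succ_of_pos {n : ℕ} {k : ℤ} (hk : 0 < k) (hkn : k ≤ n + 1) :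
    (downUpHeadEq (n + 1) k).ncard = (downUpHeadGe n (-k + 1)).ncard := by
  rw [downUpHeadEq_succ_eq_image hk.ne' (by omega),
    Set.ncard_image_of_injective _ (insertHead_injective k)]
  simp only [neg_lt_skipAbs_iff_of_pos hk, downUpHeadGe]

theorem downUpHeadEq_zero (n : ℕ) : downUpHeadEq n 0 = ∅ := by
  refine Set.eq_empty_of_forall_notMem fun l hl => ?_
  have := (hl.1.natAbs_mem_Icc (List.mem_of_mem_head? hl.2.2)).1
  simp at this

theorem downUpHeadGe_succ_self {n : ℕ} (hn : 1 ≤ n) : downUpHeadGe n (n + 1) = ∅ := by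
  refine Set.eq_empty_of_forall_notMem fun l hl => ?_
  rcases l with _ | ⟨a, t⟩
  · have := hl.1.length_eq
    simp at this
    omega
  · have h₁ := (hl.1.natAbs_mem_Icc (List.mem_cons_self (a := a))).2
    have h₂ := hl.2.2 a rfl
    omega

theorem ncard_downUpHeadGe_zero (j : ℤ) : (downUpHeadGe 0 j).ncard = 1 := by
  have : downUpHeadGe 0 j = {[]} := by
    ext l
    simp only [downUpHeadGe, IsSignedPerm, Set.mem_ofPred_eq, Set.mem_singleton_iff]
    constructor
    · rintro ⟨h, -⟩
      simpa using h
    · rintro rfl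
      exact ⟨by simp, fun i h => by simp at h, by simp⟩
  rw [this, Set.ncard_singleton]

/-- The number of down-up signed permutations of `[n]` with first entry `k` is the Arnold number
`S n k`, for either sign of `k`. -/
theorem ncard_downUpHeadEq_eq_arnold
    (S : ℕ → ℤ → ℕ)
    (hS11 : S 1 1 = 1) (hS1m1 : S 1 (-1) = 1)
    (hSnn : ∀ n : ℕ, 2 ≤ n → S n (-(n : ℤ)) = 0)
    (hSpos : ∀ (n : ℕ) (k : ℤ), 1 < k → k ≤ (n : ℤ) →
      S n k = S n (k - 1) + S (n - 1) (-k + 1))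
    (hSone : ∀ n : ℕ, 1 < n → S n 1 = S n (-1))
    (hSneg : ∀ (n : ℕ) (k : ℤ), -(n : ℤ) < k → k ≤ -1 →
      S n k = S n (k - 1) + S (n - 1) (-k))
    (n : ℕ) (hn : 1 ≤ n) (k : ℤ) (hk : k ≠ 0) (hkn : k.natAbs ≤ n) :
    (downUpHeadEq n k).ncard = S n k := by
  induction n, hn using Nat.le_induction generalizing k with
  | base =>
    obtain rfl | rfl : k = 1 ∨ k = -1 := by omega
    · rw [hS11, ncard_downUpHeadEq_succ_of_pos one_pos (by simp), ncard_downUpHeadGe_zero]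
    · rw [hS1m1, ncard_downUpHeadEq_succ_of_neg (by simp) (by simp), ncard_downUpHeadGe_zero]
  | succ n hn ih =>
    have hneg : ∀ k : ℤ, -(n + 1 : ℤ) ≤ k → k ≤ -1 →
        (downUpHeadEq (n + 1) k).ncard = S (n + 1) k := by
      intro k hk
      induction k, hk using Int.leInduction with
      | base =>
        intro _
        rw [ncard_downUpHeadEq_succ_of_neg (by omega) le_rfl, neg_neg, downUpHeadGe_succ_self hn,
          Set.ncard_empty]
        exact_mod_cast (hSnn (n + 1) (by omega)).symm
      | succ k hk ihk =>
        intro hk'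
        have hprev := ihk (by omega)
        rw [ncard_downUpHeadEq_succ_of_neg (by omega) hk] at hprev
        rw [hSneg _ _ (by push_cast; omega) hk', add_sub_cancel_right, Nat.add_sub_cancel,
          ← hprev, ← ih _ (by omega) (by omega),
          ncard_downUpHeadEq_succ_of_neg (by omega) (by omega), ncard_downUpHeadGe_eq_add hn]
        congr 3
        ring
    rcases hk.lt_or_gt with hk | hk
    · exact hneg k (by omega) (by omega)
    · replace hkn : k ≤ n + 1 := by omega
      replace hk : 1 ≤ k := by omega
      induction k, hk using Int.leInduction with
      | base =>
        rw [hSone _ (by omega), ← hneg (-1) (by omega) le_rfl,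
          ncard_downUpHeadEq_succ_of_neg (k := -1) (by omega) (by omega),
          ncard_downUpHeadEq_succ_of_pos one_pos hkn, ncard_downUpHeadGe_eq_add hn]
        simp [downUpHeadEq_zero]
      | succ k hk ihk =>
        have hprev := ihk (by omega) (by omega)
        rw [ncard_downUpHeadEq_succ_of_pos (by omega) (by omega)] at hprev
        rw [hSpos _ _ (by omega) (by push_cast; omega), add_sub_cancel_right, Nat.add_sub_cancel,
          ← hprev, ← ih _ (by omega) (by omega),
          ncard_downUpHeadEq_succ_of_pos (by omega) hkn, ncard_downUpHeadGe_eq_add hn]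
        congr 3
        ring

/-- **Arnold's theorem (negative part).** For `-n ≤ k ≤ -1`, the number of down-up
alternating permutations of type `B_n` whose first entry is `k` equals the
Arnold number `S n k`. -/
theorem downUpB_negative_first_entry_count_eq_arnold
    (S : ℕ → ℤ → ℕ)
    (hS11 : S 1 1 = 1) (hS1m1 : S 1 (-1) = 1)
    (hSnn : ∀ n : ℕ, 2 ≤ n → S n (-(n : ℤ)) = 0)
    (hSpos : ∀ (n : ℕ) (k : ℤ), 1 < k → k ≤ (n : ℤ) →
      S n k = S n (k - 1) + S (n - 1) (-k + 1))
    (hSone : ∀ n : ℕ, 1 < n → S n 1 = S n (-1))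
    (hSneg : ∀ (n : ℕ) (k : ℤ), -(n : ℤ) < k → k ≤ -1 →
      S n k = S n (k - 1) + S (n - 1) (-k))
    (n : ℕ) (k : ℤ) (hn : 1 ≤ n) (hk : -(n : ℤ) ≤ k) (hkn : k ≤ -1) :
    Nat.card {l : List ℤ // IsSignedPerm n l ∧ DownUpWord l ∧ l.head? = some k}
      = S n k := by
  exact ncard_downUpHeadEq_eq_arnold S hS11 hS1m1 hSnn hSpos hSone hSneg n hn k
    (by omega) (by omega)
end

section
/- For all integers n ≥ 1, the number of down-up alternating permutations of type B_n equals 2^n times the number of down-up alternating permutations of [n]. -/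
theorem downUpWord_map_iff {α β : Type*} [LinearOrder α] [Preorder β] {f : α → β} {s : Set α}
    (hf : StrictMonoOn f s) {w : List α} (hw : ∀ x ∈ w, x ∈ s) :
    DownUpWord (w.map f) ↔ DownUpWord w := by
  have key (i j : ℕ) (hi : i < w.length) (hj : j < w.length) : f w[i] < f w[j] ↔ w[i] < w[j] :=
    hf.lt_iff_lt (hw _ (List.getElem_mem hi)) (hw _ (List.getElem_mem hj))
  simp only [DownUpWord, List.get_eq_getElem, List.getElem_map, List.length_map]
  refine forall₂_congr fun i h => ?_
  rw [key _ _ h (Nat.lt_of_succ_lt h), key _ _ (Nat.lt_of_succ_lt h) h]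

/-- Every `n`-element finset is the image of `{1, …, n}` under an increasing map. -/
theorem exists_strictMonoOn_image_Icc_eq {α : Type*} [LinearOrder α] [Inhabited α] {n : ℕ}
    {A : Finset α} (hA : A.card = n) :
    ∃ e : ℕ → α, StrictMonoOn e (Finset.Icc 1 n : Finset ℕ) ∧ (Finset.Icc 1 n).image e = A := by
  let e : ℕ → α := fun i => if h : i - 1 < n then A.orderEmbOfFin hA ⟨i - 1, h⟩ else default
  refine ⟨e, fun i hi j hj hij => ?_, ?_⟩
  · simp only [Finset.coe_Icc, Set.mem_Icc] at hi hj
    have hi' : i - 1 < n := by omega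
    have hj' : j - 1 < n := by omega
    simp only [e, hi', hj', dif_pos, OrderEmbedding.lt_iff_lt, Fin.mk_lt_mk]
    omega
  · ext x
    rw [← Finset.mem_coe (s := A), ← Finset.range_orderEmbOfFin A hA]
    simp only [Finset.mem_image, Finset.mem_Icc, Set.mem_range]
    constructor
    · rintro ⟨i, hi, rfl⟩
      have hi' : i - 1 < n := by omega
      exact ⟨⟨i - 1, hi'⟩, by simp only [e, hi', dif_pos]⟩
    · rintro ⟨i, rfl⟩
      refine ⟨i + 1, by omega, ?_⟩
      simp [e]

/-- Attach a minus sign to exactly the elements of `T`. -/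
def attachSign (T : Finset ℕ) (i : ℕ) : ℤ := if i ∈ T then -i else i

theorem natAbs_attachSign (T : Finset ℕ) (i : ℕ) : (attachSign T i).natAbs = i := by
  unfold attachSign
  split <;> simp

theorem attachSign_injective (T : Finset ℕ) : Function.Injective (attachSign T) :=
  Function.LeftInverse.injective (natAbs_attachSign T)

theorem neg_mem_image_attachSign {n : ℕ} {T : Finset ℕ} {i : ℕ} (hi : i ∈ Finset.Icc 1 n) :
    -(i : ℤ) ∈ (Finset.Icc 1 n).image (attachSign T) ↔ i ∈ T := by
  rw [Finset.mem_image]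
  constructor
  · rintro ⟨j, -, hj⟩
    have hji : j = i := by simpa [natAbs_attachSign] using congrArg Int.natAbs hj
    subst hji
    by_contra h
    rw [attachSign, if_neg h] at hj
    rw [Finset.mem_Icc] at hi
    omega
  · exact fun h => ⟨i, hi, if_pos h⟩

theorem eq_of_image_attachSign_eq {n : ℕ} {T T' : Finset ℕ} (hT : T ⊆ Finset.Icc 1 n)
    (hT' : T' ⊆ Finset.Icc 1 n)
    (h : (Finset.Icc 1 n).image (attachSign T) = (Finset.Icc 1 n).image (attachSign T')) :
    T = T' := by
  ext i
  constructor
  · exact fun hi => (neg_mem_image_attachSign (hT hi)).1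
      (h ▸ (neg_mem_image_attachSign (hT hi)).2 hi)
  · exact fun hi => (neg_mem_image_attachSign (hT' hi)).1
      (h ▸ (neg_mem_image_attachSign (hT' hi)).2 hi)

theorem perm_range'_iff {n : ℕ} {w : List ℕ} :
    w.Perm (List.range' 1 n) ↔ w.Nodup ∧ w.toFinset = Finset.Icc 1 n := by
  have hr : (List.range' 1 n).toFinset = Finset.Icc 1 n := by
    ext i
    simp only [List.mem_toFinset, List.mem_range'_1, Finset.mem_Icc]
    omega
  constructor
  · exact fun h => ⟨h.nodup_iff.2 List.nodup_range', (List.toFinset_eq_of_perm _ _ h).trans hr⟩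
  · exact fun h => List.perm_of_nodup_nodup_toFinset_eq h.1 List.nodup_range' (h.2.trans hr.symm)

theorem isSignedPerm_of_toFinset_eq {n : ℕ} {T : Finset ℕ} {l : List ℤ} (hl : l.Nodup)
    (h : l.toFinset = (Finset.Icc 1 n).image (attachSign T)) : IsSignedPerm n l := by
  have hr := perm_range'_iff.1 (List.Perm.refl (List.range' 1 n))
  have hp : l.Perm ((List.range' 1 n).map (attachSign T)) :=
    List.perm_of_nodup_nodup_toFinset_eq hl (hr.1.map (attachSign_injective T)) (by
      rw [h, ← hr.2]
      ext x
      simp)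
  simpa [IsSignedPerm, Function.comp_def, natAbs_attachSign] using hp.map Int.natAbs

theorem IsSignedPerm.exists_toFinset_eq {n : ℕ} {l : List ℤ} (hl : IsSignedPerm n l) :
    ∃ T ⊆ Finset.Icc 1 n, l.toFinset = (Finset.Icc 1 n).image (attachSign T) := by
  obtain ⟨hnd, himg⟩ := perm_range'_iff.1 hl
  have hmem (x : ℤ) (hx : x ∈ l) : x.natAbs ∈ Finset.Icc 1 n := by
    rw [← himg]
    simpa using ⟨x, hx, rfl⟩
  have hinj := List.inj_on_of_nodup_map hnd
  refine ⟨(Finset.Icc 1 n).filter fun i => -(i : ℤ) ∈ l, Finset.filter_subset _ _, ?_⟩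
  have hsign (x : ℤ) (hx : x ∈ l) :
      attachSign ((Finset.Icc 1 n).filter fun i => -(i : ℤ) ∈ l) x.natAbs = x := by
    have hxn := hmem x hx
    simp only [attachSign, Finset.mem_filter, hxn, true_and]
    rw [Finset.mem_Icc] at hxn
    split_ifs with h
    · exact hinj h hx (by omega)
    · by_contra hne
      have hx' : -(x.natAbs : ℤ) = x := by omega
      exact h (hx'.symm ▸ hx)
  ext x
  rw [List.mem_toFinset, Finset.mem_image]
  constructor
  · exact fun hx => ⟨x.natAbs, hmem x hx, hsign x hx⟩
  · rintro ⟨i, hi, rfl⟩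
    rw [← himg, List.mem_toFinset] at hi
    obtain ⟨y, hy, rfl⟩ := List.mem_map.1 hi
    rwa [hsign y hy]

/-- The number of down-up alternating permutations of type `B_n` is `2 ^ n` times
the number of down-up alternating permutations of `[n]`. -/
theorem card_downUpB_eq_two_pow_mul_card_downUp (n : ℕ) (hn : 1 ≤ n) :
    Nat.card {l : List ℤ // IsSignedPerm n l ∧ DownUpWord l}
      = 2 ^ n * Nat.card {l : List ℕ // l.Perm (List.range' 1 n) ∧ DownUpWord l} := by
  have hcard (T : Finset ℕ) : ((Finset.Icc 1 n).image (attachSign T)).card = n := by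
    simp [Finset.card_image_of_injective _ (attachSign_injective T)]
  choose e hmono himg using fun T => exists_strictMonoOn_image_Icc_eq (hcard T)
  have hmem {w : List ℕ} (hw : w.Perm (List.range' 1 n)) :
      ∀ x ∈ w, x ∈ ((Finset.Icc 1 n : Finset ℕ) : Set ℕ) := fun x hx => by
    rw [← (perm_range'_iff.1 hw).2]
    simpa using hx
  have hfin {w : List ℕ} (hw : w.Perm (List.range' 1 n)) (T : Finset ℕ) :
      (w.map (e T)).toFinset = (Finset.Icc 1 n).image (attachSign T) := by
    rw [← himg T, ← (perm_range'_iff.1 hw).2]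
    ext x
    simp
  have hnodup {w : List ℕ} (hw : w.Perm (List.range' 1 n)) (T : Finset ℕ) :
      (w.map (e T)).Nodup :=
    (perm_range'_iff.1 hw).1.map_on fun x hx y hy h =>
      (hmono T).injOn (hmem hw x hx) (hmem hw y hy) h
  let Φ : (Finset.Icc 1 n).powerset ×
      {l : List ℕ // l.Perm (List.range' 1 n) ∧ DownUpWord l} →
      {l : List ℤ // IsSignedPerm n l ∧ DownUpWord l} := fun p =>
    ⟨p.2.1.map (e p.1), isSignedPerm_of_toFinset_eq (hnodup p.2.2.1 _) (hfin p.2.2.1 _),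
      (downUpWord_map_iff (hmono _) (hmem p.2.2.1)).2 p.2.2.2⟩
  have hΦ : Function.Bijective Φ := by
    constructor
    · rintro ⟨⟨T, hT⟩, w, hw, hwd⟩ ⟨⟨T', hT'⟩, w', hw', hwd'⟩ h
      have h' : w.map (e T) = w'.map (e T') := congrArg Subtype.val h
      obtain rfl : T = T' := eq_of_image_attachSign_eq (Finset.mem_powerset.1 hT)
        (Finset.mem_powerset.1 hT') (by rw [← hfin hw, ← hfin hw', h'])
      obtain rfl : w = w' := by
        have hleft {v : List ℕ} (hv : v.Perm (List.range' 1 n)) :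
            (v.map (e T)).map (Function.invFunOn (e T) (Finset.Icc 1 n : Finset ℕ)) = v := by
          rw [List.map_map]
          conv_rhs => rw [← List.map_id v]
          exact List.map_congr_left fun x hx =>
            (hmono T).injOn.leftInvOn_invFunOn (hmem hv x hx)
        rw [← hleft hw, h', hleft hw']
      rfl
    · rintro ⟨l, hl, hld⟩
      obtain ⟨T, hT, hlT⟩ := hl.exists_toFinset_eq
      have hex (x : ℤ) (hx : x ∈ l) :
          ∃ i ∈ ((Finset.Icc 1 n : Finset ℕ) : Set ℕ), e T i = x := by
        rw [← List.mem_toFinset, hlT, ← himg T] at hx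
        simpa using hx
      set g := Function.invFunOn (e T) (Finset.Icc 1 n : Finset ℕ)
      have hwl : (l.map g).map (e T) = l := by
        rw [List.map_map]
        conv_rhs => rw [← List.map_id l]
        exact List.map_congr_left fun x hx => Function.invFunOn_eq (hex x hx)
      have hws : ∀ i ∈ l.map g, i ∈ ((Finset.Icc 1 n : Finset ℕ) : Set ℕ) := by
        intro i hi
        obtain ⟨x, hx, rfl⟩ := List.mem_map.1 hi
        exact Function.invFunOn_mem (hex x hx)
      have hlnd : l.Nodup := (perm_range'_iff.1 hl).1.of_map _
      have hwnd : (l.map g).Nodup := List.Nodup.of_map (e T) (hwl.symm ▸ hlnd)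
      have hw : (l.map g).Perm (List.range' 1 n) := by
        refine perm_range'_iff.2 ⟨hwnd, Finset.eq_of_subset_of_card_le
          (fun i hi => hws i (List.mem_toFinset.1 hi)) ?_⟩
        rw [List.toFinset_card_of_nodup hwnd, List.length_map,
          ← List.toFinset_card_of_nodup hlnd, hlT, hcard]
        simp
      refine ⟨⟨⟨T, Finset.mem_powerset.2 hT⟩, l.map g, hw, ?_⟩, Subtype.ext hwl⟩
      exact (downUpWord_map_iff (hmono T) hws).1 (hwl.symm ▸ hld)
  rw [← Nat.card_eq_of_bijective Φ hΦ, Nat.card_prod, Nat.card_eq_fintype_card,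
    Fintype.card_coe, Finset.card_powerset, Nat.card_Icc, Nat.add_sub_cancel]
end

section
/- For all integers n ≥ 1, the number of André permutations of [n] equals the number of down-up alternating permutations of [n]; that is, #A_n = #DU_n. -/
/-- A word has a double descent if `w i > w (i+1) > w (i+2)` for some `i`. -/
def HasDoubleDescent {α : Type*} [LT α] (w : List α) : Prop :=
  ∃ i : ℕ, ∃ h : i + 2 < w.length,
    w.get ⟨i + 1, by omega⟩ < w.get ⟨i, by omega⟩ ∧
    w.get ⟨i + 2, h⟩ < w.get ⟨i + 1, by omega⟩

/-- A word ends with an ascent if it has length 1 or its last two letters increase. -/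
def EndsWithAscent {α : Type*} [LT α] (w : List α) : Prop :=
  w.length = 1 ∨ ∃ h : 2 ≤ w.length,
    w.get ⟨w.length - 2, by omega⟩ < w.get ⟨w.length - 1, by omega⟩

/-- André permutation of `[n]`, as a list that is a permutation of `1, …, n`:
every subword `σ_[k]` (entries `1, …, k` in the order they appear) has no
double descents and ends with an ascent. -/
def IsAndre (n : ℕ) (l : List ℕ) : Prop :=
  l.Perm (List.range' 1 n) ∧
  ∀ k : ℕ, 1 ≤ k → k ≤ n →
    ¬ HasDoubleDescent (l.filter (fun x => decide (x ≤ k))) ∧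
    EndsWithAscent (l.filter (fun x => decide (x ≤ k)))

/-- The Euler zigzag numbers, via their recurrence over even indices. -/
def zigzag : ℕ → ℕ
  | 0 => 1
  | n + 1 => ∑ k : Fin (n + 1),
      if Even (k : ℕ) then n.choose k * (zigzag k * zigzag (n - k)) else 0
  decreasing_by all_goals omega

theorem zigzag_succ (n : ℕ) : zigzag (n + 1) = ∑ k ∈ Finset.range (n + 1),
    if Even k then n.choose k * (zigzag k * zigzag (n - k)) else 0 := by
  rw [zigzag, Finset.sum_range]

section DownUp

variable {α : Type*}

/-- `w` is an up-down alternating word: `w 0 < w 1 > w 2 < w 3 > ⋯` (0-indexed). -/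
def UpDownWord [LT α] (w : List α) : Prop :=
  @DownUpWord α ⟨fun a b => b < a⟩ w

theorem downUpWord_nil [LT α] : DownUpWord ([] : List α) := by
  intro i h; simp at h

theorem downUpWord_singleton [LT α] (a : α) : DownUpWord [a] := by
  intro i h; simp at h

theorem upDownWord_nil [LT α] : UpDownWord ([] : List α) :=
  @downUpWord_nil α ⟨fun a b => b < a⟩

theorem downUpWord_cons_cons [LT α] (a b : α) (l : List α) :
    DownUpWord (a :: b :: l) ↔ b < a ∧ UpDownWord (b :: l) := by
  constructor
  · intro h
    refine ⟨(h 0 (by simp)).1 rfl, fun i hi => ?_⟩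
    have hi' : i + 1 + 1 < (a :: b :: l).length := Nat.succ_lt_succ hi
    exact ⟨fun p => (h (i + 1) hi').2 (by omega), fun p => (h (i + 1) hi').1 (by omega)⟩
  · rintro ⟨h₁, h₂⟩ i hi
    cases i with
    | zero => exact ⟨fun _ => h₁, fun p => by simp at p⟩
    | succ i =>
      have hi' : i + 1 < (b :: l).length := by simpa using hi
      exact ⟨fun p => (h₂ i hi').2 (by omega), fun p => (h₂ i hi').1 (by omega)⟩

theorem upDownWord_cons_cons [LT α] (a b : α) (l : List α) :
    UpDownWord (a :: b :: l) ↔ a < b ∧ DownUpWord (b :: l) :=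
  @downUpWord_cons_cons α ⟨fun a b => b < a⟩ a b l

theorem downUpWord_cons_cons_cons [LT α] (a b c : α) (l : List α) :
    DownUpWord (a :: b :: c :: l) ↔ b < a ∧ b < c ∧ DownUpWord (c :: l) := by
  rw [downUpWord_cons_cons, upDownWord_cons_cons]

theorem downUpWord_append_cons [LinearOrder α] (m : α) (v : List α) (hv : ∀ x ∈ v, x < m) :
    ∀ u : List α, (∀ x ∈ u, x < m) → (DownUpWord (u ++ m :: v) ↔
      Even u.length ∧ DownUpWord u ∧ UpDownWord v)
  | [], _ => by
    cases v with
    | nil => simp [downUpWord_nil, downUpWord_singleton, upDownWord_nil]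
    | cons b l =>
      simp only [List.nil_append, downUpWord_cons_cons, downUpWord_nil, List.length_nil]
      simp [hv b (by simp)]
  | [a], hu => by
    have := hu a (by simp)
    simp [downUpWord_cons_cons, this.le]
  | a :: b :: u, hu => by
    have ih := downUpWord_append_cons m v hv u (fun x hx => hu x (by simp [hx]))
    have hb := hu b (by simp)
    cases u with
    | nil =>
      simp only [List.nil_append, List.cons_append, downUpWord_cons_cons_cons] at ih ⊢
      simp only [ih, downUpWord_cons_cons]
      simp [hb, downUpWord_nil]
      tauto
    | cons c u =>
      simp only [List.cons_append, downUpWord_cons_cons_cons] at ih ⊢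
      simp only [ih, List.length_cons, Nat.even_add_one]
      tauto

open scoped Classical in
/-- The down-up alternating words using each letter of `s` exactly once. -/
noncomputable def downUpWords [LinearOrder α] (s : Finset α) : Finset (List α) :=
  {l ∈ s.toList.permutations.toFinset | DownUpWord l}

theorem mem_downUpWords [LinearOrder α] {s : Finset α} {l : List α} :
    l ∈ downUpWords s ↔ (l : Multiset α) = s.val ∧ DownUpWord l := by
  simp only [downUpWords, Finset.mem_filter, List.mem_toFinset, List.mem_permutations,
    ← Multiset.coe_eq_coe, Finset.coe_toList]

/-- The up-down alternating words using each letter of `s` exactly once. -/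
noncomputable def upDownWords [LinearOrder α] (s : Finset α) : Finset (List α) :=
  @downUpWords α (inferInstanceAs (LinearOrder αᵒᵈ)) s

theorem mem_upDownWords [LinearOrder α] {s : Finset α} {l : List α} :
    l ∈ upDownWords s ↔ (l : Multiset α) = s.val ∧ UpDownWord l :=
  @mem_downUpWords α (inferInstanceAs (LinearOrder αᵒᵈ)) s l

theorem mem_of_mem_upDownWords [LinearOrder α] {s : Finset α} {l : List α}
    (h : l ∈ upDownWords s) {x : α} : x ∈ l ↔ x ∈ s := by
  rw [← Finset.mem_val, ← (mem_upDownWords.1 h).1, Multiset.mem_coe]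

theorem mem_of_mem_downUpWords [LinearOrder α] {s : Finset α} {l : List α}
    (h : l ∈ downUpWords s) {x : α} : x ∈ l ↔ x ∈ s := by
  rw [← Finset.mem_val, ← (mem_downUpWords.1 h).1, Multiset.mem_coe]

theorem length_of_mem_downUpWords [LinearOrder α] {s : Finset α} {l : List α}
    (h : l ∈ downUpWords s) : l.length = s.card := by
  rw [Finset.card_def, ← (mem_downUpWords.1 h).1, Multiset.coe_card]

theorem card_downUpWords_eq_sum [LinearOrder α] (s : Finset α) (m : α) (hm : ∀ x ∈ s, x < m) :
    (downUpWords (insert m s)).card = ∑ t ∈ s.powerset with Even t.card,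
      (downUpWords t).card * (upDownWords (s \ t)).card := by
  classical
  have hms : m ∉ s := fun h => lt_irrefl _ (hm m h)
  simp_rw [← Finset.card_product]
  rw [← Finset.card_sigma]
  symm
  refine Finset.card_bij (fun p _ => p.2.1 ++ m :: p.2.2) ?_ ?_ ?_
  · rintro ⟨t, u, v⟩ h
    simp only [Finset.mem_sigma, Finset.mem_filter, Finset.mem_powerset, Finset.mem_product] at h
    obtain ⟨⟨ht, he⟩, hu, hv⟩ := h
    have hv' : ∀ x ∈ v, x ∈ s \ t := fun x => (mem_of_mem_upDownWords hv).1
    have hu' : ∀ x ∈ u, x ∈ t := fun x => (mem_of_mem_downUpWords hu).1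
    refine mem_downUpWords.2 ⟨?_, (downUpWord_append_cons m v ?_ u ?_).2 ⟨?_, ?_, ?_⟩⟩
    · dsimp only
      rw [Finset.insert_val_of_notMem hms, ← Multiset.coe_add, ← Multiset.cons_coe,
        (mem_downUpWords.1 hu).1, Multiset.add_cons,
        (mem_upDownWords.1 hv).1, Finset.sdiff_val, add_tsub_cancel_of_le (Finset.val_le_iff.2 ht)]
    · exact fun x hx => hm x (Finset.mem_sdiff.1 (hv' x hx)).1
    · exact fun x hx => hm x (ht (hu' x hx))
    · rwa [length_of_mem_downUpWords hu]
    · exact (mem_downUpWords.1 hu).2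
    · exact (mem_upDownWords.1 hv).2
  · rintro ⟨t, u, v⟩ h ⟨t', u', v'⟩ h' heq
    simp only [Finset.mem_sigma, Finset.mem_filter, Finset.mem_powerset, Finset.mem_product] at h h'
    obtain ⟨⟨ht, -⟩, hu, hv⟩ := h
    obtain ⟨⟨ht', -⟩, hu', hv'⟩ := h'
    have hn : m ∉ u := fun h => hms (ht ((mem_of_mem_downUpWords hu).1 h))
    have hn' : m ∉ u' := fun h => hms (ht' ((mem_of_mem_downUpWords hu').1 h))
    have hw : m ∉ v := fun h => hms (Finset.mem_sdiff.1 ((mem_of_mem_upDownWords hv).1 h)).1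
    obtain ⟨rfl, rfl⟩ : u = u' ∧ v = v' := by
      have := List.append_eq_append_iff.1 heq
      rcases this with ⟨a, h₁, h₂⟩ | ⟨a, h₁, h₂⟩ <;> cases a <;> simp_all
    have : t = t' := by
      ext x; rw [← mem_of_mem_downUpWords hu, mem_of_mem_downUpWords hu']
    subst this
    rfl
  · intro l hl
    have hml : m ∈ l := (mem_of_mem_downUpWords hl).2 (Finset.mem_insert_self _ _)
    obtain ⟨u, v, rfl⟩ := List.append_of_mem hml
    obtain ⟨h₁, h₂⟩ := mem_downUpWords.1 hl
    rw [Finset.insert_val_of_notMem hms, ← Multiset.coe_add, ← Multiset.cons_coe,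
      Multiset.add_cons, Multiset.cons_inj_right] at h₁
    have hsub : ∀ x, x ∈ s ↔ x ∈ u ∨ x ∈ v := by
      intro x; rw [← Finset.mem_val, ← h₁]; simp
    have hnd : (u ++ v).Nodup := by
      rw [← Multiset.coe_nodup, ← Multiset.coe_add, h₁]; exact s.nodup
    have hun : u.Nodup := hnd.of_append_left
    have hut : u.toFinset ⊆ s := fun x hx => (hsub x).2 (Or.inl (by simpa using hx))
    have huv : (u : Multiset α) = u.toFinset.val := by
      rw [List.toFinset_val, hun.dedup]
    have hvv : (v : Multiset α) = (s \ u.toFinset).val := by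
      rw [Finset.sdiff_val, ← huv, ← h₁, add_tsub_cancel_left]
    rw [downUpWord_append_cons m v (fun x hx => hm x ((hsub x).2 (Or.inr hx))) u
      (fun x hx => hm x ((hsub x).2 (Or.inl hx)))] at h₂
    refine ⟨⟨u.toFinset, u, v⟩, ?_, rfl⟩
    simp only [Finset.mem_sigma, Finset.mem_filter, Finset.mem_powerset, Finset.mem_product]
    refine ⟨⟨hut, ?_⟩, mem_downUpWords.2 ⟨huv, h₂.2.1⟩, mem_upDownWords.2 ⟨hvv, h₂.2.2⟩⟩
    rw [List.toFinset_card_of_nodup hun]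
    exact h₂.1

theorem card_downUpWords [LinearOrder α] (s : Finset α) :
    (downUpWords s).card = zigzag s.card := by
  induction hn : s.card using Nat.strong_induction_on generalizing α with
  | _ n ih =>
  rcases s.eq_empty_or_nonempty with rfl | hs
  · obtain rfl : n = 0 := by simpa using hn.symm
    have : downUpWords (∅ : Finset α) = {[]} := by
      ext l
      simp only [mem_downUpWords, Finset.empty_val, Multiset.coe_eq_zero, Finset.mem_singleton]
      exact ⟨fun h => h.1, fun h => ⟨h, h ▸ downUpWord_nil⟩⟩
    simp [this, zigzag]
  · set m := s.max' hs
    have hins : insert m (s.erase m) = s := Finset.insert_erase (s.max'_mem hs)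
    have hlt : ∀ x ∈ s.erase m, x < m := fun x hx => s.lt_max'_of_mem_erase_max' hs hx
    obtain ⟨k, rfl⟩ : ∃ k, n = k + 1 := ⟨n - 1, by have := hs.card_pos; omega⟩
    have hk : (s.erase m).card = k := by
      rw [Finset.card_erase_of_mem (s.max'_mem hs), hn]; rfl
    rw [← hins, card_downUpWords_eq_sum _ m hlt, Finset.sum_filter, zigzag_succ]
    have h : ∀ t ∈ (s.erase m).powerset, (if Even t.card then
        (downUpWords t).card * (upDownWords (s.erase m \ t)).card else 0) =
        if Even t.card then zigzag t.card * zigzag (k - t.card) else 0 := by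
      intro t ht
      have hts := Finset.mem_powerset.1 ht
      have hc := Finset.card_le_card hts
      have hd : (s.erase m \ t).card = k - t.card := by
        rw [Finset.card_sdiff_of_subset hts, hk]
      have hup : (upDownWords (s.erase m \ t)).card = zigzag (k - t.card) :=
        @ih (k - t.card) (by omega) α (inferInstanceAs (LinearOrder αᵒᵈ)) _ hd
      rw [ih t.card (by omega) t rfl, hup]
    rw [Finset.sum_congr rfl h,
      Finset.sum_powerset_apply_card (fun j => if Even j then zigzag j * zigzag (k - j) else 0), hk]
    refine Finset.sum_congr rfl fun j _ => ?_
    split_ifs <;> simp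

end DownUp

section Series

open PowerSeries

/-- The exponential generating function of the zigzag numbers of even index (the secant). -/
noncomputable def secSeries : ℚ⟦X⟧ := mk fun n => if Even n then (zigzag n : ℚ) / n.factorial else 0

/-- The exponential generating function of the zigzag numbers of odd index (the tangent). -/
noncomputable def tanSeries : ℚ⟦X⟧ := mk fun n => if Even n then 0 else (zigzag n : ℚ) / n.factorial

theorem zigzag_succ_div_factorial (n : ℕ) :
    (zigzag (n + 1) : ℚ) / (n + 1).factorial * (n + 1) = ∑ p ∈ Finset.HasAntidiagonal.antidiagonal n,
      if Even p.1 then (zigzag p.1 : ℚ) / p.1.factorial * ((zigzag p.2 : ℚ) / p.2.factorial)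
      else 0 := by
  rw [Finset.Nat.sum_antidiagonal_eq_sum_range_succ_mk, zigzag_succ, Nat.factorial_succ]
  push_cast
  have h0 : (n.factorial : ℚ) ≠ 0 := by exact_mod_cast n.factorial_ne_zero
  have h1 : (n + 1 : ℚ) ≠ 0 := by positivity
  rw [div_mul_eq_mul_div, mul_comm (n + 1 : ℚ), mul_div_mul_right _ _ h1, Finset.sum_div]
  refine Finset.sum_congr rfl fun k hk => ?_
  have hk : k ≤ n := by simpa [Nat.lt_succ_iff] using hk
  split_ifs
  · rw [Nat.cast_choose ℚ hk]
    field_simp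
  · simp

theorem derivative_secSeries : d⁄dX ℚ secSeries = secSeries * tanSeries := by
  ext n
  rw [coeff_derivative, coeff_mul]
  simp only [secSeries, tanSeries, coeff_mk]
  by_cases hn : Even n
  · rw [if_neg (by simpa [Nat.even_add_one] using hn), zero_mul]
    symm
    refine Finset.sum_eq_zero fun p hp => ?_
    have : p.1 + p.2 = n := by simpa using hp
    rw [← this, Nat.even_add] at hn
    split_ifs <;> simp_all
  · rw [if_pos (by simpa [Nat.even_add_one] using hn), zigzag_succ_div_factorial]
    refine Finset.sum_congr rfl fun p hp => ?_
    have : p.1 + p.2 = n := by simpa using hp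
    rw [← this, Nat.even_add] at hn
    split_ifs <;> simp_all

theorem derivative_tanSeries : d⁄dX ℚ tanSeries = secSeries * secSeries := by
  ext n
  rw [coeff_derivative, coeff_mul]
  simp only [secSeries, tanSeries, coeff_mk]
  by_cases hn : Even n
  · rw [if_neg (by simpa [Nat.even_add_one] using hn), zigzag_succ_div_factorial]
    refine Finset.sum_congr rfl fun p hp => ?_
    have : p.1 + p.2 = n := by simpa using hp
    rw [← this, Nat.even_add] at hn
    split_ifs <;> simp_all
  · rw [if_pos (by simpa [Nat.even_add_one] using hn), zero_mul]
    symm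
    refine Finset.sum_eq_zero fun p hp => ?_
    have : p.1 + p.2 = n := by simpa using hp
    rw [← this, Nat.even_add] at hn
    split_ifs <;> simp_all

theorem constantCoeff_secSeries : constantCoeff secSeries = 1 := by
  simp [secSeries, ← coeff_zero_eq_constantCoeff_apply, zigzag]

theorem constantCoeff_tanSeries : constantCoeff tanSeries = 0 := by
  simp [tanSeries, ← coeff_zero_eq_constantCoeff_apply]

theorem constantCoeff_iterate_derivative_secSeries_add_tanSeries (n : ℕ) :
    constantCoeff ((d⁄dX ℚ)^[n] (secSeries + tanSeries)) = zigzag n := by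
  have h0 : (n.factorial : ℚ) ≠ 0 := by exact_mod_cast n.factorial_ne_zero
  rw [constantCoeff_iterate_derivative]
  simp only [secSeries, tanSeries, map_add, coeff_mk]
  split_ifs <;> simp <;> field_simp

end Series

section Andre

theorem hasDoubleDescent_cons_cons_cons {α : Type*} [LT α] (a b c : α) (l : List α) :
    HasDoubleDescent (a :: b :: c :: l) ↔
      (b < a ∧ c < b) ∨ HasDoubleDescent (b :: c :: l) := by
  constructor
  · rintro ⟨i, hi, h⟩
    cases i with
    | zero => exact Or.inl h
    | succ i => exact Or.inr ⟨i, by simpa using hi, h⟩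
  · rintro (h | ⟨i, hi, h⟩)
    · exact ⟨0, by simp, h⟩
    · exact ⟨i + 1, by simpa using hi, h⟩

/-- `w` has no double descents and ends with an ascent. -/
def IsGood {α : Type*} [LT α] (w : List α) : Prop :=
  ¬ HasDoubleDescent w ∧ EndsWithAscent w

section IsGood

variable {α : Type*} [LT α]

theorem not_isGood_nil : ¬ IsGood ([] : List α) := by
  rintro ⟨-, h | ⟨h, -⟩⟩ <;> simp at h

theorem isGood_singleton (a : α) : IsGood [a] := by
  refine ⟨?_, Or.inl rfl⟩
  rintro ⟨i, hi, -⟩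
  simp at hi

theorem isGood_pair (a b : α) : IsGood [a, b] ↔ a < b := by
  constructor
  · rintro ⟨-, h | ⟨_, h⟩⟩
    · simp at h
    · exact h
  · intro h
    refine ⟨?_, Or.inr ⟨le_rfl, h⟩⟩
    rintro ⟨i, hi, -⟩
    simp at hi

theorem isGood_cons_cons_cons (a b c : α) (l : List α) :
    IsGood (a :: b :: c :: l) ↔ ¬ (b < a ∧ c < b) ∧ IsGood (b :: c :: l) := by
  have h : EndsWithAscent (a :: b :: c :: l) ↔ EndsWithAscent (b :: c :: l) := by
    simp [EndsWithAscent]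
  rw [IsGood, IsGood, hasDoubleDescent_cons_cons_cons, h]
  tauto

end IsGood

section Insertion

variable {α : Type*} [LinearOrder α]

/-- All ways to insert the new maximal letter `m` in a word without double descents ending with
an ascent, so that the result has these properties too. -/
def maxInsertions (m : α) : List α → List (List α)
  | [] => []
  | [a] => [[a, m]]
  | a :: b :: l =>
    if b < a then (a :: m :: b :: l) :: (maxInsertions m l).map (fun w => a :: b :: w)
    else (m :: a :: b :: l) :: (maxInsertions m (b :: l)).map (fun w => a :: w)

theorem IsGood.of_cons_cons {a b : α} {l : List α} (h : IsGood (a :: b :: l)) :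
    IsGood (b :: l) := by
  cases l with
  | nil => exact isGood_singleton b
  | cons c l => exact ((isGood_cons_cons_cons _ _ _ _).1 h).2

theorem IsGood.exists_of_lt {a b : α} {l : List α} (h : IsGood (a :: b :: l)) (hba : b < a) :
    ∃ c t, l = c :: t ∧ b ≤ c ∧ IsGood (c :: t) := by
  cases l with
  | nil => exact absurd ((isGood_pair a b).1 h) hba.asymm
  | cons c t =>
    have h' := (isGood_cons_cons_cons _ _ _ _).1 h
    exact ⟨c, t, rfl, not_lt.1 fun hc => h'.1 ⟨hba, hc⟩, h'.2.of_cons_cons⟩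

theorem mem_maxInsertions_shape {m : α} : ∀ {w l : List α}, l ∈ maxInsertions m w →
    ∃ u v, w = u ++ v ∧ l = u ++ m :: v
  | [], l, h => by simp [maxInsertions] at h
  | [a], l, h => ⟨[a], [], rfl, by simpa [maxInsertions] using h⟩
  | a :: b :: t, l, h => by
    rw [maxInsertions] at h
    split_ifs at h
    · rcases List.mem_cons.1 h with rfl | h
      · exact ⟨[a], b :: t, rfl, rfl⟩
      · obtain ⟨l', hl', rfl⟩ := List.mem_map.1 h
        obtain ⟨u, v, rfl, rfl⟩ := mem_maxInsertions_shape hl'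
        exact ⟨a :: b :: u, v, rfl, rfl⟩
    · rcases List.mem_cons.1 h with rfl | h
      · exact ⟨[], a :: b :: t, rfl, rfl⟩
      · obtain ⟨l', hl', rfl⟩ := List.mem_map.1 h
        obtain ⟨u, v, h₁, rfl⟩ := mem_maxInsertions_shape hl'
        exact ⟨a :: u, v, by simp [h₁], rfl⟩

/-- The first letter of an insertion is the old first letter or `m`. -/
theorem exists_cons_cons_of_mem_maxInsertions {m c : α} {t l : List α}
    (h : l ∈ maxInsertions m (c :: t)) :
    ∃ d e s, l = d :: e :: s ∧ (d = c ∨ d = m) := by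
  obtain ⟨u, v, h₁, rfl⟩ := mem_maxInsertions_shape h
  cases u with
  | nil => obtain rfl : c :: t = v := h₁; exact ⟨m, c, t, rfl, Or.inr rfl⟩
  | cons x u =>
    obtain ⟨rfl, -⟩ := List.cons.inj h₁
    cases u with
    | nil => exact ⟨c, m, v, rfl, Or.inl rfl⟩
    | cons y u => exact ⟨c, y, _, rfl, Or.inl rfl⟩

theorem isGood_of_mem_maxInsertions {m : α} : ∀ {w l : List α}, IsGood w → (∀ x ∈ w, x < m) →
    l ∈ maxInsertions m w → IsGood l
  | [], l, _, _, h => by simp [maxInsertions] at h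
  | [a], l, _, hm, h => by
    obtain rfl : l = [a, m] := by simpa [maxInsertions] using h
    exact (isGood_pair _ _).2 (hm a (by simp))
  | a :: b :: t, l, hw, hm, h => by
    have ha := hm a (by simp)
    have hb := hm b (by simp)
    rw [maxInsertions] at h
    split_ifs at h with hba
    · obtain ⟨c, s, rfl, hbc, hs⟩ := hw.exists_of_lt hba
      rcases List.mem_cons.1 h with rfl | h
      · simp only [isGood_cons_cons_cons]
        exact ⟨fun h => ha.asymm h.1, fun h => hbc.not_gt h.2, hw.of_cons_cons⟩
      · obtain ⟨l', hl', rfl⟩ := List.mem_map.1 h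
        have hg := isGood_of_mem_maxInsertions hs (fun x hx => hm x (by simp_all)) hl'
        obtain ⟨d, e, r, rfl, hd⟩ := exists_cons_cons_of_mem_maxInsertions hl'
        have hbd : b ≤ d := by rcases hd with rfl | rfl <;> [exact hbc; exact hb.le]
        simp only [isGood_cons_cons_cons a, isGood_cons_cons_cons b]
        exact ⟨fun h => hbd.not_gt h.2, fun h => hbd.not_gt h.1, hg⟩
    · rcases List.mem_cons.1 h with rfl | h
      · simp only [isGood_cons_cons_cons m]
        exact ⟨fun h => hba h.2, hw⟩
      · obtain ⟨l', hl', rfl⟩ := List.mem_map.1 h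
        have hg := isGood_of_mem_maxInsertions hw.of_cons_cons
          (fun x hx => hm x (List.mem_cons_of_mem _ hx)) hl'
        obtain ⟨d, e, r, rfl, hd⟩ := exists_cons_cons_of_mem_maxInsertions hl'
        rw [isGood_cons_cons_cons]
        have had : a ≤ d := by rcases hd with rfl | rfl <;> [exact not_lt.1 hba; exact ha.le]
        exact ⟨fun h => had.not_gt h.1, hg⟩

theorem IsGood.of_append {v : List α} (hv : v ≠ []) : ∀ {u : List α}, IsGood (u ++ v) → IsGood v
  | [], h => h
  | [a], h => by
    obtain ⟨b, t, rfl⟩ := List.exists_cons_of_ne_nil hv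
    exact IsGood.of_cons_cons h
  | _ :: b :: u, h => IsGood.of_append hv (u := b :: u) (IsGood.of_cons_cons h)

theorem mem_maxInsertions {m : α} : ∀ {u v : List α}, IsGood (u ++ v) → (∀ x ∈ u ++ v, x < m) →
    IsGood (u ++ m :: v) → u ++ m :: v ∈ maxInsertions m (u ++ v)
  | [], [], hw, _, _ => absurd hw not_isGood_nil
  | [], [a], _, hm, h => absurd ((isGood_pair m a).1 h) (hm a (by simp)).asymm
  | [], a :: b :: t, _, hm, h => by
    have := ((isGood_cons_cons_cons _ _ _ _).1 h).1
    have hba : ¬ b < a := fun hba => this ⟨hm a (by simp), hba⟩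
    simp [maxInsertions, hba]
  | [a], [], _, _, _ => by simp [maxInsertions]
  | [a], b :: t, hw, hm, h => by
    by_cases hba : b < a
    · simp [maxInsertions, hba]
    · have := mem_maxInsertions (u := []) (v := b :: t) hw.of_cons_cons
        (fun x hx => hm x (List.mem_cons_of_mem _ hx)) (IsGood.of_cons_cons h)
      simp only [List.cons_append, List.nil_append] at this ⊢
      simp [maxInsertions, hba, this]
  | a :: b :: u, v, hw, hm, h => by
    by_cases hba : b < a
    · obtain ⟨c, t, hct, -, hg⟩ := IsGood.exists_of_lt hw hba
      rw [← hct] at hg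
      have := mem_maxInsertions (u := u) (v := v) hg
        (fun x hx => hm x (List.mem_cons_of_mem _ (List.mem_cons_of_mem _ hx)))
        (IsGood.of_append (u := [a, b]) (by simp) h)
      simp [maxInsertions, hba, this]
    · have := mem_maxInsertions (u := b :: u) (v := v) (IsGood.of_cons_cons hw)
        (fun x hx => hm x (List.mem_cons_of_mem _ hx)) (IsGood.of_cons_cons h)
      simp only [List.cons_append] at this ⊢
      simp [maxInsertions, hba, this]

theorem nodup_maxInsertions {m : α} : ∀ {w : List α}, (∀ x ∈ w, x < m) → (maxInsertions m w).Nodup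
  | [], _ => by simp [maxInsertions]
  | [a], _ => by simp [maxInsertions]
  | a :: b :: t, hm => by
    have h₁ := nodup_maxInsertions (w := t) (fun x hx => hm x (by simp [hx]))
    have h₂ := nodup_maxInsertions (w := b :: t) (fun x hx => hm x (List.mem_cons_of_mem _ hx))
    have ha := (hm a (by simp)).ne
    have hb := (hm b (by simp)).ne
    rw [maxInsertions]
    split_ifs
    · refine List.nodup_cons.2 ⟨?_, h₁.map fun _ _ h => by simpa using h⟩
      simp [hb]
    · refine List.nodup_cons.2 ⟨?_, h₂.map fun _ _ h => by simpa using h⟩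
      simp [ha]

/-- The monomial recording the descents of a word: a descent pair and the last letter contribute
`x`, any other letter contributes `y`. -/
def descentWeight {R : Type*} [CommRing R] (x y : R) : List α → R
  | [] => 1
  | [_] => x
  | a :: b :: l => if b < a then x * descentWeight x y l else y * descentWeight x y (b :: l)

theorem descentWeight_cons_of_le {R : Type*} [CommRing R] (x y : R) {a b : α} (h : a ≤ b)
    (l : List α) : descentWeight x y (a :: b :: l) = y * descentWeight x y (b :: l) := by
  rw [descentWeight, if_neg h.not_gt]

theorem descentWeight_cons_of_lt {R : Type*} [CommRing R] (x y : R) {a b : α} (h : b < a)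
    (l : List α) : descentWeight x y (a :: b :: l) = x * descentWeight x y l := by
  rw [descentWeight, if_pos h]

/-- Inserting a new maximal letter acts on weights as the derivation `x ↦ xy`, `y ↦ x`. -/
theorem sum_descentWeight_maxInsertions {k R : Type*} [CommRing k] [CommRing R]
    [Algebra k R] {x y : R} (D : Derivation k R R)
    (hx : D x = x * y) (hy : D y = x) {m : α} :
    ∀ {w : List α}, IsGood w → (∀ x ∈ w, x < m) →
      ((maxInsertions m w).map (descentWeight x y)).sum = D (descentWeight x y w)
  | [], hw, _ => absurd hw not_isGood_nil
  | [a], _, hm => by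
    have ha := hm a (by simp)
    simp [maxInsertions, descentWeight, ha.le.not_gt, hx, mul_comm]
  | a :: b :: t, hw, hm => by
    have ha := hm a (by simp)
    have hb := hm b (by simp)
    rw [maxInsertions]
    split_ifs with hba
    · obtain ⟨c, s, rfl, hbc, hs⟩ := hw.exists_of_lt hba
      have ih := sum_descentWeight_maxInsertions D hx hy hs
        (fun x hx => hm x (by simp_all))
      have : (maxInsertions m (c :: s)).map (descentWeight x y ∘ fun w => a :: b :: w) =
          (maxInsertions m (c :: s)).map (fun w => x * descentWeight x y w) :=
        List.map_congr_left fun l _ => descentWeight_cons_of_lt x y hba l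
      rw [List.map_cons, List.sum_cons, List.map_map, this, List.sum_map_mul_left, ih,
        descentWeight_cons_of_le x y ha.le, descentWeight_cons_of_lt x y hb,
        descentWeight_cons_of_lt x y hba, Derivation.leibniz, hx]
      simp only [smul_eq_mul]
      ring
    · have ih := sum_descentWeight_maxInsertions D hx hy hw.of_cons_cons
        (fun x hx => hm x (List.mem_cons_of_mem _ hx))
      have : (maxInsertions m (b :: t)).map (descentWeight x y ∘ fun w => a :: w) =
          (maxInsertions m (b :: t)).map (fun w => y * descentWeight x y w) := by
        refine List.map_congr_left fun l hl => ?_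
        obtain ⟨d, e, r, rfl, hd⟩ := exists_cons_cons_of_mem_maxInsertions hl
        refine descentWeight_cons_of_le x y ?_ _
        rcases hd with rfl | rfl <;> [exact not_lt.1 hba; exact ha.le]
      rw [List.map_cons, List.sum_cons, List.map_map, this, List.sum_map_mul_left, ih,
        descentWeight_cons_of_lt x y ha,
        descentWeight_cons_of_le x y (not_lt.1 hba), Derivation.leibniz, hy]
      simp only [smul_eq_mul]
      ring

theorem map_descentWeight_eq_one {R S : Type*} [CommRing R] [CommRing S] (f : R →+* S) {x y : R}
    (hx : f x = 1) (hy : f y = 1) : ∀ w : List α, f (descentWeight x y w) = 1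
  | [] => by simp [descentWeight]
  | [_] => hx
  | a :: b :: l => by
    rw [descentWeight]
    split_ifs <;> simp [hx, hy, map_descentWeight_eq_one f hx hy l,
      map_descentWeight_eq_one f hx hy (b :: l)]

end Insertion

theorem IsAndre.lt {n : ℕ} {l : List ℕ} (h : IsAndre n l) : ∀ x ∈ l, x < n + 1 := by
  intro x hx
  have := h.1.mem_iff.1 hx
  rw [List.mem_range'_1] at this
  omega

theorem filter_le_eq_self {n : ℕ} {l : List ℕ} (h : ∀ x ∈ l, x < n + 1) :
    l.filter (fun x => decide (x ≤ n)) = l :=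
  List.filter_eq_self.2 fun x hx => by simpa using Nat.lt_succ_iff.1 (h x hx)

theorem IsAndre.isGood {n : ℕ} {l : List ℕ} (hn : 1 ≤ n) (h : IsAndre n l) : IsGood l := by
  have := h.2 n hn le_rfl
  rwa [filter_le_eq_self h.lt] at this

theorem filter_le_append_cons {k n : ℕ} (hk : k ≤ n) (u v : List ℕ) :
    (u ++ (n + 1) :: v).filter (fun x => decide (x ≤ k)) =
      (u ++ v).filter (fun x => decide (x ≤ k)) := by
  rw [List.filter_append, List.filter_cons_of_neg (by simpa using hk), List.filter_append]

theorem perm_range'_succ_iff (n : ℕ) (u v : List ℕ) :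
    (u ++ (n + 1) :: v).Perm (List.range' 1 (n + 1)) ↔ (u ++ v).Perm (List.range' 1 n) := by
  have h : (List.range' 1 (n + 1)).Perm ((n + 1) :: List.range' 1 n) := by
    rw [List.range'_concat, Nat.one_mul, Nat.add_comm 1 n]
    exact List.perm_append_singleton _ _
  rw [← List.perm_cons (n + 1) (l₁ := u ++ v)]
  exact ⟨fun h' => List.perm_middle.symm.trans (h'.trans h),
    fun h' => List.perm_middle.trans (h'.trans h.symm)⟩

theorem isAndre_succ_iff {n : ℕ} (hn : 1 ≤ n) {l : List ℕ} :
    IsAndre (n + 1) l ↔ ∃ w, IsAndre n w ∧ l ∈ maxInsertions (n + 1) w := by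
  constructor
  · intro h
    have hmem : n + 1 ∈ l := h.1.mem_iff.2 (by rw [List.mem_range'_1]; omega)
    obtain ⟨u, v, rfl⟩ := List.append_of_mem hmem
    have hw : IsAndre n (u ++ v) := by
      refine ⟨(perm_range'_succ_iff n u v).1 h.1, fun k hk hkn => ?_⟩
      rw [← filter_le_append_cons hkn]
      exact h.2 k hk (by omega)
    exact ⟨u ++ v, hw, mem_maxInsertions (hw.isGood hn) hw.lt (h.isGood (by omega))⟩
  · rintro ⟨w, hw, hl⟩
    have hg := isGood_of_mem_maxInsertions (hw.isGood hn) hw.lt hl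
    obtain ⟨u, v, rfl, rfl⟩ := mem_maxInsertions_shape hl
    have hp := (perm_range'_succ_iff n u v).2 hw.1
    refine ⟨hp, fun k hk hkn => ?_⟩
    rcases Nat.lt_or_ge n k with h | h
    · obtain rfl : k = n + 1 := by omega
      rw [filter_le_eq_self]
      · exact hg
      · intro x hx
        have := hp.mem_iff.1 hx
        rw [List.mem_range'_1] at this
        omega
    · rw [filter_le_append_cons h]
      exact hw.2 k hk h

/-- The André permutations of `[n + 1]`. -/
def andreWords : ℕ → List (List ℕ)
  | 0 => [[1]]
  | n + 1 => (andreWords n).flatMap (maxInsertions (n + 2))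

theorem mem_andreWords {n : ℕ} {l : List ℕ} : l ∈ andreWords n ↔ IsAndre (n + 1) l := by
  induction n generalizing l with
  | zero =>
    simp only [andreWords, List.mem_singleton]
    constructor
    · rintro rfl
      refine ⟨by simp, fun k hk hk' => ?_⟩
      obtain rfl : k = 1 := by omega
      exact isGood_singleton 1
    · intro h
      simpa using h.1
  | succ n ih =>
    simp only [andreWords, List.mem_flatMap, ih, isAndre_succ_iff (n := n + 1) (by omega)]

theorem nodup_andreWords (n : ℕ) : (andreWords n).Nodup := by
  induction n with
  | zero => simp [andreWords]
  | succ n ih =>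
    refine List.nodup_flatMap.2
      ⟨fun w hw => nodup_maxInsertions (mem_andreWords.1 hw).lt, ?_⟩
    refine ih.imp_of_mem fun {w w'} hw hw' hne l hl hl' => hne ?_
    obtain ⟨u, v, rfl, rfl⟩ := mem_maxInsertions_shape hl
    obtain ⟨u', v', rfl, h⟩ := mem_maxInsertions_shape hl'
    rw [← filter_le_eq_self (mem_andreWords.1 hw).lt, ← filter_le_eq_self (mem_andreWords.1 hw').lt,
      ← filter_le_append_cons le_rfl u v, ← filter_le_append_cons le_rfl u' v', h]

open PowerSeries in
theorem sum_descentWeight_andreWords (n : ℕ) :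
    ((andreWords n).map
      (descentWeight (secSeries * (secSeries + tanSeries)) (secSeries + tanSeries))).sum =
      (d⁄dX ℚ)^[n + 1] (secSeries + tanSeries) := by
  have hy : d⁄dX ℚ (secSeries + tanSeries) = secSeries * (secSeries + tanSeries) := by
    rw [map_add, derivative_secSeries, derivative_tanSeries]
    ring
  have hx : d⁄dX ℚ (secSeries * (secSeries + tanSeries)) =
      secSeries * (secSeries + tanSeries) * (secSeries + tanSeries) := by
    rw [Derivation.leibniz, hy, derivative_secSeries]
    simp only [smul_eq_mul]
    ring
  induction n with
  | zero => simp [andreWords, descentWeight, hy]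
  | succ n ih =>
    rw [Function.iterate_succ_apply', ← ih, map_list_sum, List.map_map, andreWords,
      List.map_flatMap, List.flatMap_def, List.sum_flatten, List.map_map]
    refine congrArg List.sum (List.map_congr_left fun w hw => ?_)
    have hw := mem_andreWords.1 hw
    exact sum_descentWeight_maxInsertions (d⁄dX ℚ) hx hy
      (hw.isGood (by omega)) hw.lt

open PowerSeries in
theorem length_andreWords (n : ℕ) : (andreWords n).length = zigzag (n + 1) := by
  have h := congrArg (constantCoeff (R := ℚ)) (sum_descentWeight_andreWords n)
  rw [constantCoeff_iterate_derivative_secSeries_add_tanSeries, map_list_sum, List.map_map] at h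
  have hone : ∀ w ∈ andreWords n, (constantCoeff (R := ℚ) ∘ descentWeight
      (secSeries * (secSeries + tanSeries)) (secSeries + tanSeries)) w = 1 := fun w _ =>
    map_descentWeight_eq_one _ (by simp [constantCoeff_secSeries, constantCoeff_tanSeries])
      (by simp [constantCoeff_secSeries, constantCoeff_tanSeries]) w
  rw [List.map_congr_left hone] at h
  have h' : ((andreWords n).length : ℚ) = zigzag (n + 1) := by simpa using h
  exact_mod_cast h'

end Andre

/-- The number of André permutations of `[n]` equals the number of down-up
alternating permutations of `[n]`. -/
theorem card_andre_eq_card_downUp (n : ℕ) (hn : 1 ≤ n) :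
    Nat.card {l : List ℕ // IsAndre n l}
      = Nat.card {l : List ℕ // l.Perm (List.range' 1 n) ∧ DownUpWord l} := by
  obtain ⟨k, rfl⟩ : ∃ k, n = k + 1 := ⟨n - 1, by omega⟩
  have h₁ : Nat.card {l : List ℕ // IsAndre (k + 1) l} = zigzag (k + 1) := by
    rw [← length_andreWords, ← List.toFinset_card_of_nodup (nodup_andreWords k)]
    exact Nat.subtype_card _ fun l => by rw [List.mem_toFinset, mem_andreWords]
  have h₂ : Nat.card {l : List ℕ // l.Perm (List.range' 1 (k + 1)) ∧ DownUpWord l} =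
      zigzag (k + 1) := by
    have hc : (⟨List.range' 1 (k + 1), List.nodup_range'⟩ : Finset ℕ).card = k + 1 := by
      simp [Finset.card_def]
    rw [← hc, ← card_downUpWords]
    exact Nat.subtype_card _ fun l => by rw [mem_downUpWords, Multiset.coe_eq_coe, hc]
  rw [h₁, h₂]
end

section
/- For all integers n ≥ 2 and 1 ≤ k ≤ n, the number of André permutations of [n] whose last entry is k equals the number of Simsun permutations of [n-1] whose last entry is k-1; that is, #A_{n,k} = #RS_{n-1,k-1}. -/
/-- Simsun permutation of `[n]`: every subword `σ_[k]` has no double descents. -/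
def IsSimsun (n : ℕ) (l : List ℕ) : Prop :=
  l.Perm (List.range' 1 n) ∧
  ∀ k : ℕ, 1 ≤ k → k ≤ n →
    ¬ HasDoubleDescent (l.filter (fun x => decide (x ≤ k)))

namespace AndreSimsun

/-- The number of descents of a word. -/
def des : List ℕ → ℕ
  | [] => 0
  | [_] => 0
  | a :: b :: l => (if b < a then 1 else 0) + des (b :: l)

theorem hasDoubleDescent_cons_cons_cons {a b c : ℕ} {l : List ℕ} :
    HasDoubleDescent (a :: b :: c :: l) ↔ (b < a ∧ c < b) ∨ HasDoubleDescent (b :: c :: l) := by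
  constructor
  · rintro ⟨i, hi, h⟩
    cases i with
    | zero => exact Or.inl (by simpa using h)
    | succ i => exact Or.inr ⟨i, by simpa using hi, by simpa using h⟩
  · rintro (h | ⟨i, hi, h⟩)
    · exact ⟨0, by simp, by simpa using h⟩
    · exact ⟨i + 1, by simpa using hi, by simpa using h⟩

theorem not_hasDoubleDescent_of_length_le {l : List ℕ} (hl : l.length ≤ 2) :
    ¬ HasDoubleDescent l := by
  rintro ⟨i, hi, -⟩
  omega

theorem hasDoubleDescent_cons {l : List ℕ} (h : HasDoubleDescent l) (y : ℕ) :
    HasDoubleDescent (y :: l) := by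
  obtain ⟨i, hi, h⟩ := h
  exact ⟨i + 1, by simp only [List.length_cons]; omega, by simpa using h⟩

theorem des_cons_eq_or (z : ℕ) (R : List ℕ) :
    des (z :: R) = des R ∨ des (z :: R) = des R + 1 := by
  cases R with
  | nil => simp [des]
  | cons c R => simp only [des]; split_ifs <;> omega

theorem hasDoubleDescent_cons_cons_of_lt {x z : ℕ} (h : z < x) (R : List ℕ) :
    HasDoubleDescent (x :: z :: R) ↔ HasDoubleDescent (z :: R) ∨ des (z :: R) = des R + 1 := by
  cases R with
  | nil => simp [des, not_hasDoubleDescent_of_length_le]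
  | cons c R =>
    rw [hasDoubleDescent_cons_cons_cons]
    simp only [des]
    split_ifs <;> grind

theorem hasDoubleDescent_cons_cons_of_not_lt {x z : ℕ} (h : ¬ z < x) (R : List ℕ) :
    HasDoubleDescent (x :: z :: R) ↔ HasDoubleDescent (z :: R) := by
  cases R with
  | nil => simp [not_hasDoubleDescent_of_length_le]
  | cons c R => simp [hasDoubleDescent_cons_cons_cons, h]

theorem endsWithAscent_cons_cons_cons {a b c : ℕ} {l : List ℕ} :
    EndsWithAscent (a :: b :: c :: l) ↔ EndsWithAscent (b :: c :: l) := by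
  simp [EndsWithAscent]

/-- Appending the letter `0` to a word of positive letters turns a final descent into a
double descent. -/
theorem not_hasDoubleDescent_append_zero : ∀ {w : List ℕ}, w ≠ [] → w.Nodup →
    (∀ a ∈ w, 0 < a) →
    (¬ HasDoubleDescent (w ++ [0]) ↔ ¬ HasDoubleDescent w ∧ EndsWithAscent w)
  | [], h, _, _ => absurd rfl h
  | [a], _, _, _ => by
    simp [not_hasDoubleDescent_of_length_le, EndsWithAscent]
  | [a, b], _, hn, hp => by
    have : a ≠ b := by simpa using hn
    have : 0 < b := hp b (by simp)
    simp [hasDoubleDescent_cons_cons_cons, not_hasDoubleDescent_of_length_le, EndsWithAscent]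
    omega
  | a :: b :: c :: l, _, hn, hp => by
    have ih := not_hasDoubleDescent_append_zero (w := b :: c :: l) (by simp) hn.of_cons
      (fun x hx => hp x (List.mem_cons_of_mem _ hx))
    simp only [List.cons_append] at ih ⊢
    rw [hasDoubleDescent_cons_cons_cons, hasDoubleDescent_cons_cons_cons,
      endsWithAscent_cons_cons_cons]
    tauto

variable {t : List ℕ} {x : ℕ}

theorem exists_eq_cons_of_mem_insertions {l v : List ℕ} (h : v ∈ l.permutations'Aux x) :
    (∃ v', v = x :: v') ∨ ∃ c l' v', l = c :: l' ∧ v = c :: v' := by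
  cases l with
  | nil => simp_all
  | cons c l =>
    simp only [List.permutations'Aux, List.mem_cons, List.mem_map] at h
    grind

/-- Prefixing a letter to the words obtained by inserting a large letter after the first place. -/
theorem cons_insertion_iff {y z : ℕ} {l v : List ℕ} (hz : z < x)
    (hw : ¬ HasDoubleDescent (y :: z :: (l ++ t))) (hv : v ∈ l.permutations'Aux x) :
    HasDoubleDescent (y :: z :: (v ++ t)) ↔ HasDoubleDescent (z :: (v ++ t)) := by
  rcases exists_eq_cons_of_mem_insertions hv with ⟨v', rfl⟩ | ⟨c, l', v', rfl, rfl⟩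
  · simp [hasDoubleDescent_cons_cons_cons, hz.not_gt]
  · simp only [List.cons_append, hasDoubleDescent_cons_cons_cons] at hw ⊢
    tauto

open Classical in
/-- The statistics (descents, last letter) of the admissible insertions of a large letter
after the first place. -/
theorem inner_insertions_stat (ht : t = [] ∨ t = [0]) (l : List ℕ) (y : ℕ)
    (hx : ∀ a ∈ y :: l, a < x) (hpos : ∀ a ∈ y :: l, 0 < a)
    (hw : ¬ HasDoubleDescent (y :: (l ++ t))) :
    ∃ a e, a + t.length = des (y :: (l ++ t)) ∧ e + a + des (l ++ t) = l.length ∧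
      ((((l.permutations'Aux x).map (List.cons y)).filter
        (fun w => ¬ HasDoubleDescent (w ++ t)) : List (List ℕ)) : Multiset (List ℕ)).map
          (fun w => (des (w ++ t), w.getLast?)) =
      (a + t.length, some x) ::ₘ (Multiset.replicate a (a + t.length, (y :: l).getLast?) +
        Multiset.replicate e (a + t.length + 1, (y :: l).getLast?)) := by
  induction l generalizing y with
  | nil =>
    have hy := hx y (by simp)
    have hy0 := hpos y (by simp)
    refine ⟨0, 0, ?_⟩
    rcases ht with rfl | rfl
    · simp [des, not_hasDoubleDescent_of_length_le, hy.le]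
    · simp [des, not_hasDoubleDescent_of_length_le, hasDoubleDescent_cons_cons_cons, hy.not_gt,
        hy0, hy0.trans hy]
  | cons z l ih =>
    have hw' : ¬ HasDoubleDescent (z :: (l ++ t)) := fun h => hw (hasDoubleDescent_cons h y)
    have hz := hx z (by simp)
    have hy := hx y (by simp)
    obtain ⟨a, e, h1, h2, h3⟩ := ih z (fun b hb => hx b (List.mem_cons_of_mem _ hb))
      (fun b hb => hpos b (List.mem_cons_of_mem _ hb)) hw'
    set s := if z < y then 1 else 0 with hs
    have key : ((((l.permutations'Aux x).map (List.cons z)).map (List.cons y)).filter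
        (fun w => ¬ HasDoubleDescent (w ++ t))).map (fun w => (des (w ++ t), w.getLast?)) =
        ((((l.permutations'Aux x).map (List.cons z)).filter
        (fun w => ¬ HasDoubleDescent (w ++ t))).map (fun w => (des (w ++ t), w.getLast?))).map
          (fun p => (p.1 + s, p.2)) := by
      simp only [List.filter_map, List.map_map]
      rw [List.filter_congr (q := (fun w => decide ¬ HasDoubleDescent (w ++ t)) ∘ List.cons z)]
      · refine List.map_congr_left fun v hv => ?_
        simp [des, hs, add_comm]
      · intro v hv
        simp [cons_insertion_iff hz hw hv]
    have key' := congrArg (Multiset.map (fun p : ℕ × Option ℕ => (p.1 + s, p.2))) h3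
    simp only [Multiset.map_coe, Multiset.map_cons, Multiset.map_add, Multiset.map_replicate]
      at key'
    have hdz := des_cons_eq_or z (l ++ t)
    have hd : des (y :: z :: (l ++ t)) = s + des (z :: (l ++ t)) := rfl
    have hnew : HasDoubleDescent (y :: x :: z :: (l ++ t)) ↔
        des (z :: (l ++ t)) = des (l ++ t) + 1 := by
      rw [hasDoubleDescent_cons_cons_of_not_lt hy.not_gt, hasDoubleDescent_cons_cons_of_lt hz]
      tauto
    have hdnew : des (y :: x :: z :: (l ++ t)) = des (z :: (l ++ t)) + 1 := by
      simp [des, hy.not_gt, hz, add_comm]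
    have hlast : (y :: x :: z :: l).getLast? = (z :: l).getLast? := by simp
    have hlast' : (y :: z :: l).getLast? = (z :: l).getLast? := by simp
    simp only [List.permutations'Aux, List.map_cons, List.filter_cons, List.cons_append, hnew,
      Multiset.map_coe, hd, hlast']
    by_cases hf : des (z :: (l ++ t)) = des (l ++ t) + 1
    · have hs0 : s = 0 := by
        by_contra h
        have : z < y := by by_contra h'; simp [hs, h'] at h
        exact hw ((hasDoubleDescent_cons_cons_of_lt this _).2 (Or.inr hf))
      refine ⟨a, e, by omega, by simp; omega, ?_⟩
      simp only [hf, not_true, decide_false, Bool.false_eq_true, if_false]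
      rw [key, key']
      simp [hs0]
    · have hsor : s = 0 ∨ s = 1 := by rw [hs]; split_ifs <;> simp
      rcases hsor with hs0 | hs1
      · refine ⟨a, e + 1, by omega, by simp; omega, ?_⟩
        simp only [hf, not_false_eq_true, decide_true, if_true, List.map_cons, List.cons_append]
        rw [← Multiset.cons_coe, key, key', hdnew, hlast, ← h1, hs0, Multiset.replicate_succ]
        simp only [add_zero, Multiset.add_cons]
        rw [Multiset.cons_swap]
      · refine ⟨a + 1, e, by omega, by simp; omega, ?_⟩
        simp only [hf, not_false_eq_true, decide_true, if_true, List.map_cons, List.cons_append]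
        rw [← Multiset.cons_coe, key, key', hdnew, hlast, ← h1, hs1, Multiset.replicate_succ]
        simp only [Multiset.cons_add, add_right_comm _ _ 1]
        rw [Multiset.cons_swap]

open Classical in
/-- The words with tail `t` obtained by inserting a large letter so that no double descent arises. -/
noncomputable def insertions (t : List ℕ) (x : ℕ) (w : List ℕ) : List (List ℕ) :=
  (w.permutations'Aux x).filter (fun v => ¬ HasDoubleDescent (v ++ t))

/-- The number of descents of `w ++ t`, not counting the descent into a tail `t = [0]`,
and the last letter of `w`. -/
def stat (t w : List ℕ) : ℕ × Option ℕ := (des (w ++ t) - t.length, w.getLast?)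

/-- The statistics of the children of a word with statistics `p` in the insertion tree. -/
def childStats (m x : ℕ) (p : ℕ × Option ℕ) : Multiset (ℕ × Option ℕ) :=
  (p.1, some x) ::ₘ (Multiset.replicate p.1 p + Multiset.replicate (m - 2 * p.1) (p.1 + 1, p.2))

theorem insertions_stat (ht : t = [] ∨ t = [0]) {w : List ℕ} (hne : w ≠ [])
    (hx : ∀ a ∈ w, a < x) (hpos : ∀ a ∈ w, 0 < a) (hw : ¬ HasDoubleDescent (w ++ t)) :
    ((insertions t x w : List (List ℕ)) : Multiset (List ℕ)).map (stat t) =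
      childStats (w.length - t.length) x (stat t w) := by
  classical
  obtain ⟨y, l, rfl⟩ := List.exists_cons_of_ne_nil hne
  obtain ⟨a, e, h1, h2, h3⟩ := inner_insertions_stat ht l y hx hpos hw
  have hy := hx y (by simp)
  have key := congrArg (Multiset.map (fun p : ℕ × Option ℕ => (p.1 - t.length, p.2))) h3
  simp only [Multiset.map_coe, Multiset.map_cons, Multiset.map_add, Multiset.map_replicate,
    List.map_map, Function.comp_def, Nat.add_sub_cancel, add_right_comm a t.length 1] at key
  have hst : stat t (y :: l) = (a, (y :: l).getLast?) := by
    simp [stat, ← h1]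
  have hstx : stat t (x :: y :: l) = (a + 1, (y :: l).getLast?) := by
    have : des (x :: y :: (l ++ t)) = a + 1 + t.length := by
      simp [des, hy, ← h1]; omega
    simp [stat, this]
  have hnew : HasDoubleDescent (x :: y :: (l ++ t)) ↔
      des (y :: (l ++ t)) = des (l ++ t) + 1 := by
    rw [hasDoubleDescent_cons_cons_of_lt hy]
    exact or_iff_right hw
  have hdy := des_cons_eq_or y (l ++ t)
  simp only [insertions, List.permutations'Aux, List.filter_cons, List.cons_append, hnew,
    childStats, hst, Multiset.map_coe]
  by_cases hf : des (y :: (l ++ t)) = des (l ++ t) + 1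
  · have : (y :: l).length - t.length - 2 * a = e := by simp; omega
    simp only [hf, not_true, decide_false, Bool.false_eq_true, if_false, this]
    exact key
  · have : (y :: l).length - t.length - 2 * a = e + 1 := by simp; omega
    simp only [hf, not_false_eq_true, decide_true, if_true, List.map_cons, this,
      Multiset.replicate_succ, Multiset.add_cons]
    rw [← Multiset.cons_coe, hstx, Multiset.cons_swap]
    congr 1

/-- The permutations of `[n]` all of whose subwords on `1, …, k`, followed by `t`, have no
double descent. -/
noncomputable def perms (t : List ℕ) : ℕ → List (List ℕ)
  | 0 => [[]]
  | n + 1 => (perms t n).flatMap (insertions t (n + 1))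

theorem perm_cons_of_mem_insertions {w v : List ℕ} (h : v ∈ w.permutations'Aux x) :
    v.Perm (x :: w) := by
  induction w generalizing v with
  | nil => simp_all
  | cons a w ih =>
    simp only [List.permutations'Aux, List.mem_cons, List.mem_map] at h
    rcases h with rfl | ⟨u, hu, rfl⟩
    · rfl
    · exact ((ih hu).cons a).trans (List.Perm.swap x a w)

theorem filter_eq_of_mem_insertions {w v : List ℕ} (h : v ∈ w.permutations'Aux x)
    {p : ℕ → Bool} (hp : p x = false) : v.filter p = w.filter p := by
  induction w generalizing v with
  | nil => simp_all
  | cons a w ih =>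
    simp only [List.permutations'Aux, List.mem_cons, List.mem_map] at h
    rcases h with rfl | ⟨u, hu, rfl⟩
    · simp [hp]
    · simp [List.filter_cons, ih hu]

theorem exists_mem_insertions {v : List ℕ} (h : x ∈ v) : ∃ w : List ℕ, v ∈ w.permutations'Aux x := by
  induction v with
  | nil => simp at h
  | cons a v ih =>
    by_cases hxa : x = a
    · subst hxa
      exact ⟨v, by cases v <;> simp⟩
    · obtain ⟨w, hw⟩ := ih (by simpa [hxa] using h)
      exact ⟨a :: w, by simp [hw]⟩

theorem filter_le_eq_self {n : ℕ} {w : List ℕ} (h : w.Perm (List.range' 1 n)) :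
    w.filter (fun a => decide (a ≤ n)) = w := by
  refine List.filter_eq_self.2 fun a ha => ?_
  have := h.mem_iff.1 ha
  simp only [List.mem_range'_1] at this
  simp; omega

theorem cons_perm_range'_succ {n : ℕ} {w : List ℕ} :
    ((n + 1) :: w).Perm (List.range' 1 (n + 1)) ↔ w.Perm (List.range' 1 n) := by
  have h : (List.range' 1 (n + 1)).Perm ((n + 1) :: List.range' 1 n) := by
    rw [List.range'_1_concat, add_comm 1 n]
    exact List.perm_append_singleton _ _
  exact ⟨fun hw => (hw.trans h).cons_inv, fun hw => (hw.cons _).trans h.symm⟩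

theorem mem_perms {n : ℕ} {w : List ℕ} : w ∈ perms t n ↔ w.Perm (List.range' 1 n) ∧
    ∀ k, 1 ≤ k → k ≤ n → ¬ HasDoubleDescent (w.filter (fun a => decide (a ≤ k)) ++ t) := by
  induction n generalizing w with
  | zero =>
    simp only [perms, List.mem_singleton, List.range'_zero, List.perm_nil]
    exact ⟨fun h => ⟨h, by omega⟩, fun h => h.1⟩
  | succ n ih =>
    simp only [perms, List.mem_flatMap, insertions, List.mem_filter, decide_eq_true_eq]
    constructor
    · rintro ⟨u, hu, hwu, hw⟩
      obtain ⟨hu, hu'⟩ := ih.1 hu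
      have hperm := (perm_cons_of_mem_insertions hwu).trans (cons_perm_range'_succ.2 hu)
      refine ⟨hperm, fun k hk hkn => ?_⟩
      rcases Nat.lt_or_ge n k with h | h
      · obtain rfl : k = n + 1 := by omega
        rwa [filter_le_eq_self hperm]
      · rw [filter_eq_of_mem_insertions hwu (by simp; omega)]
        exact hu' k hk h
    · rintro ⟨hw, hw'⟩
      obtain ⟨u, hu⟩ := exists_mem_insertions
        (hw.mem_iff.2 (List.mem_range'_1.2 ⟨by omega, by omega⟩) : n + 1 ∈ w)
      refine ⟨u, ih.2 ⟨cons_perm_range'_succ.1 ((perm_cons_of_mem_insertions hu).symm.trans hw),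
        fun k hk hkn => ?_⟩, hu, ?_⟩
      · rw [← filter_eq_of_mem_insertions hu (by simp; omega)]
        exact hw' k hk (by omega)
      · have := hw' (n + 1) (by omega) le_rfl
        rwa [filter_le_eq_self hw] at this

theorem pos_and_lt_of_mem_perms {n : ℕ} {w : List ℕ} (h : w ∈ perms t n) {a : ℕ} (ha : a ∈ w) :
    0 < a ∧ a < n + 1 := by
  have := (mem_perms.1 h).1.mem_iff.1 ha
  simp only [List.mem_range'_1] at this
  omega

theorem nodup_perms (t : List ℕ) (n : ℕ) : (perms t n).Nodup := by
  induction n with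
  | zero => simp [perms]
  | succ n ih =>
    refine List.nodup_flatMap.2 ⟨fun w hw => ?_, ?_⟩
    · refine List.Nodup.filter _ (List.nodup_permutations'Aux_of_notMem _ _ fun h => ?_)
      have := pos_and_lt_of_mem_perms hw h
      omega
    · refine ih.pairwise_of_forall_ne fun u hu v hv huv w hwu hwv => huv ?_
      have h1 := filter_eq_of_mem_insertions (List.mem_filter.1 hwu).1
        (p := fun a => decide (a ≤ n)) (by simp)
      have h2 := filter_eq_of_mem_insertions (List.mem_filter.1 hwv).1
        (p := fun a => decide (a ≤ n)) (by simp)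
      rw [filter_le_eq_self (mem_perms.1 hu).1] at h1
      rw [filter_le_eq_self (mem_perms.1 hv).1] at h2
      exact h1.symm.trans h2

theorem perms_stat_succ (ht : t = [] ∨ t = [0]) {n : ℕ} (hn : 1 ≤ n) :
    ((perms t (n + 1) : List (List ℕ)) : Multiset (List ℕ)).map (stat t) =
      (((perms t n : List (List ℕ)) : Multiset (List ℕ)).map (stat t)).bind
        (childStats (n - t.length) (n + 1)) := by
  rw [perms, ← Multiset.coe_bind, Multiset.map_bind, Multiset.bind_map]
  refine Multiset.bind_congr fun w hw => ?_
  have hw : w ∈ perms t n := by simpa using hw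
  obtain ⟨hp, hd⟩ := mem_perms.1 hw
  have hlen : w.length = n := by simpa using hp.length_eq
  have := hd n hn le_rfl
  rw [filter_le_eq_self hp] at this
  rw [insertions_stat ht (by rintro rfl; simp at hlen; omega)
    (fun a ha => (pos_and_lt_of_mem_perms hw ha).2)
    (fun a ha => (pos_and_lt_of_mem_perms hw ha).1) this, hlen]

theorem map_childStats (m x : ℕ) (p : ℕ × Option ℕ) :
    (childStats m x p).map (fun p => (p.1, p.2.map (· + 1))) =
      childStats m (x + 1) (p.1, p.2.map (· + 1)) := by
  simp [childStats]

theorem perms_one (ht : t = [] ∨ t = [0]) : perms t 1 = [[1]] := by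
  rcases ht with rfl | rfl <;>
    simp [perms, insertions, not_hasDoubleDescent_of_length_le]

theorem perms_stat_shift {n : ℕ} (hn : 1 ≤ n) :
    ((perms [0] (n + 1) : List (List ℕ)) : Multiset (List ℕ)).map (stat [0]) =
      (((perms [] n : List (List ℕ)) : Multiset (List ℕ)).map (stat [])).map
        (fun p => (p.1, p.2.map (· + 1))) := by
  induction n, hn using Nat.le_induction with
  | base =>
    rw [perms_stat_succ (Or.inr rfl) le_rfl, perms_one (Or.inr rfl), perms_one (Or.inl rfl)]
    simp [stat, des, childStats]
  | succ n hn ih =>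
    rw [perms_stat_succ (Or.inr rfl) (by omega), ih, perms_stat_succ (Or.inl rfl) hn,
      Multiset.map_bind, Multiset.bind_map]
    simp only [map_childStats]
    simp

theorem isSimsun_iff {n : ℕ} {w : List ℕ} : IsSimsun n w ↔ w ∈ perms [] n := by
  simp [IsSimsun, mem_perms]

theorem isAndre_iff {n : ℕ} {w : List ℕ} : IsAndre n w ↔ w ∈ perms [0] n := by
  rw [IsAndre, mem_perms]
  refine and_congr_right fun hw => forall₃_congr fun k hk hkn => ?_
  refine (not_hasDoubleDescent_append_zero ?_ ?_ fun a ha => ?_).symm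
  · refine List.ne_nil_of_mem (a := 1) (List.mem_filter.2 ⟨hw.mem_iff.2 ?_, by simpa using hk⟩)
    simp; omega
  · exact (hw.nodup_iff.2 List.nodup_range').filter _
  · have := hw.mem_iff.1 (List.mem_of_mem_filter ha)
    simp only [List.mem_range'_1] at this
    omega

theorem card_getLast?_eq (t : List ℕ) (n k : ℕ) :
    Nat.card {w : List ℕ // w ∈ perms t n ∧ w.getLast? = some k} =
      (((perms t n : List (List ℕ)) : Multiset (List ℕ)).map (stat t)).countP
        (fun p => p.2 = some k) := by
  rw [Nat.subtype_card ((perms t n).toFinset.filter (fun w => w.getLast? = some k)) (by simp),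
    Multiset.countP_map, Finset.card_def, Finset.filter_val, List.toFinset_val,
    (nodup_perms t n).dedup]
  rfl

end AndreSimsun

/-- For `n ≥ 2` and `1 ≤ k ≤ n`, the number of André permutations of `[n]` with last
entry `k` equals the number of Simsun permutations of `[n-1]` with last entry `k-1`. -/
theorem card_andre_last_eq_card_simsun_last
    (n k : ℕ) (hn : 2 ≤ n) (hk : 1 ≤ k) (hkn : k ≤ n) :
    Nat.card {l : List ℕ // IsAndre n l ∧ l.getLast? = some k}
      = Nat.card {l : List ℕ // IsSimsun (n - 1) l ∧ l.getLast? = some (k - 1)} := by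
  obtain ⟨n, rfl⟩ : ∃ m, n = m + 1 := ⟨n - 1, by omega⟩
  obtain ⟨k, rfl⟩ : ∃ j, k = j + 1 := ⟨k - 1, by omega⟩
  simp only [AndreSimsun.isAndre_iff, AndreSimsun.isSimsun_iff, AndreSimsun.card_getLast?_eq,
    Nat.add_sub_cancel]
  rw [AndreSimsun.perms_stat_shift (by omega), Multiset.countP_map, Multiset.countP_eq_card_filter]
  simp
end

section
/- For all integers n ≥ 2 and 2 ≤ k ≤ n, the number of Simsun permutations of [n-1] whose last entry is k-1 equals the Entringer number E_{n,k}; that is, #RS_{n-1,k-1} = E_{n,k}. -/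
namespace Simsun

section PowerSeries

open PowerSeries

/-- The power series `sec + tan`. -/
noncomputable def secAddTan : ℚ⟦X⟧ := (1 + sin ℚ) * (cos ℚ)⁻¹

theorem derivative_sin : d⁄dX ℚ (sin ℚ) = cos ℚ := by
  ext n
  rw [coeff_derivative, sin, cos, coeff_mk, coeff_mk]
  rcases Nat.even_or_odd' n with ⟨m, rfl | rfl⟩
  · have h : (2 * m + 1) / 2 = m := by omega
    have : ((2 * m).factorial : ℚ) ≠ 0 := by positivity
    simp [h, Nat.factorial_succ]
    field_simp
  · simp [parity_simps]

theorem derivative_cos : d⁄dX ℚ (cos ℚ) = -sin ℚ := by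
  ext n
  rw [map_neg, coeff_derivative, sin, cos, coeff_mk, coeff_mk]
  rcases Nat.even_or_odd' n with ⟨m, rfl | rfl⟩
  · simp [parity_simps]
  · have h : (2 * m + 1 + 1) / 2 = m + 1 := by omega
    have h' : (2 * m + 1) / 2 = m := by omega
    have : ((2 * m + 1).factorial : ℚ) ≠ 0 := by positivity
    simp [h, h', parity_simps, Nat.factorial_succ (2 * m + 1), pow_succ]
    field_simp

theorem constantCoeff_sin : constantCoeff (sin ℚ) = 0 := by
  rw [← coeff_zero_eq_constantCoeff_apply, sin, coeff_mk]
  simp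

theorem constantCoeff_cos : constantCoeff (cos ℚ) = 1 := by
  rw [← coeff_zero_eq_constantCoeff_apply, cos, coeff_mk]
  simp

theorem sin_sq_add_cos_sq : sin ℚ ^ 2 + cos ℚ ^ 2 = 1 := by
  apply derivative.ext
  · simp only [map_add, derivative_pow, derivative_sin, derivative_cos, derivative_one]
    push_cast
    ring
  · simp [constantCoeff_sin, constantCoeff_cos]

theorem cos_ne_zero : cos ℚ ≠ 0 := fun h => by
  simpa [h] using constantCoeff_cos

theorem cos_mul_secAddTan : cos ℚ * secAddTan = 1 + sin ℚ := by
  rw [secAddTan, mul_left_comm,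
    PowerSeries.mul_inv_cancel _ (by simp [constantCoeff_cos]), mul_one]

theorem sin_mul_secAddTan : sin ℚ * secAddTan = secAddTan - cos ℚ :=
  mul_left_cancel₀ cos_ne_zero <| by
    linear_combination (sin ℚ - 1) * cos_mul_secAddTan + sin_sq_add_cos_sq

theorem cos_mul_derivative_secAddTan : cos ℚ * d⁄dX ℚ secAddTan = secAddTan := by
  have h := congrArg (d⁄dX ℚ) cos_mul_secAddTan
  simp only [Derivation.leibniz, smul_eq_mul, map_add, derivative_one, derivative_sin,
    derivative_cos] at h
  linear_combination h + sin_mul_secAddTan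

theorem derivative_derivative_secAddTan :
    d⁄dX ℚ (d⁄dX ℚ secAddTan) = secAddTan * d⁄dX ℚ secAddTan := by
  have h := congrArg (d⁄dX ℚ) cos_mul_derivative_secAddTan
  simp only [Derivation.leibniz, smul_eq_mul, derivative_cos] at h
  apply mul_left_cancel₀ cos_ne_zero
  linear_combination h - d⁄dX ℚ secAddTan * cos_mul_secAddTan

theorem constantCoeff_secAddTan : constantCoeff secAddTan = 1 := by
  simp [secAddTan, constantCoeff_cos, constantCoeff_sin]

theorem constantCoeff_derivative_secAddTan : constantCoeff (d⁄dX ℚ secAddTan) = 1 := by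
  have h := congrArg constantCoeff cos_mul_derivative_secAddTan
  simpa [constantCoeff_cos, constantCoeff_secAddTan] using h

/-- The value at `0` of the `p`-th derivative of `f` times the `q`-th derivative of
`sec + tan`. -/
noncomputable def taylorMul (f : ℚ⟦X⟧) (p q : ℕ) : ℚ :=
  constantCoeff ((d⁄dX ℚ)^[p] (f * (d⁄dX ℚ)^[q] secAddTan))

theorem taylorMul_cos_succ (p q : ℕ) :
    taylorMul (cos ℚ) (p + 1) q = taylorMul (cos ℚ) p (q + 1) - taylorMul (sin ℚ) p q := by
  simp only [taylorMul]
  rw [← map_sub, ← iterate_map_sub, Function.iterate_succ_apply, Function.iterate_succ_apply']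
  congr 2
  simp only [Derivation.leibniz, smul_eq_mul, derivative_cos]
  ring

theorem taylorMul_sin_succ (p q : ℕ) :
    taylorMul (sin ℚ) (p + 1) q = taylorMul (sin ℚ) p (q + 1) + taylorMul (cos ℚ) p q := by
  simp only [taylorMul]
  rw [← map_add, ← iterate_map_add, Function.iterate_succ_apply, Function.iterate_succ_apply']
  congr 2
  simp only [Derivation.leibniz, smul_eq_mul, derivative_sin]
  ring

theorem taylorMul_sin_zero_left (q : ℕ) : taylorMul (sin ℚ) 0 q = 0 := by
  simp [taylorMul, constantCoeff_sin]

theorem taylorMul_cos_one_right (n : ℕ) :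
    taylorMul (cos ℚ) n 1 = taylorMul (cos ℚ) 0 n := by
  simp [taylorMul, cos_mul_derivative_secAddTan, constantCoeff_cos]

theorem taylorMul_sin_succ_left (p q : ℕ) :
    taylorMul (sin ℚ) (p + 1) (q + 1) = taylorMul (cos ℚ) (q + 1) (p + 1) := by
  induction h : p + q using Nat.strong_induction_on generalizing p q with
  | _ n ih =>
    induction p generalizing q with
    | zero =>
      rw [taylorMul_sin_succ, taylorMul_sin_zero_left, taylorMul_cos_one_right,
        zero_add]
    | succ p ihp =>
      rw [taylorMul_sin_succ, ihp (q + 1) (by omega), taylorMul_cos_succ (q + 1),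
        ih _ (by omega) q p rfl, sub_add_cancel]

theorem entringer_eq_taylorMul (E : ℕ → ℕ → ℕ) (hE11 : E 1 1 = 1)
    (hEn1 : ∀ n : ℕ, 2 ≤ n → E n 1 = 0)
    (hErec : ∀ n k : ℕ, 2 ≤ k → k ≤ n → E n k = E n (k - 1) + E (n - 1) (n + 1 - k))
    (p k : ℕ) : (E (p + k + 2) (k + 2) : ℚ) = taylorMul (cos ℚ) p (k + 1) := by
  induction h : p + k using Nat.strong_induction_on generalizing p k with
  | _ n ih =>
    subst h
    induction k generalizing p with
    | zero =>
      rw [hErec _ _ (by omega) (by omega), show 0 + 2 - 1 = 1 by rfl, hEn1 _ (by omega)]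
      cases p with
      | zero =>
        simp [hE11, taylorMul, cos_mul_derivative_secAddTan, constantCoeff_secAddTan]
      | succ p =>
        have h := ih p (by omega) 0 p (by omega)
        rw [taylorMul_cos_one_right, ← h]
        simp [show p + 1 + 2 - 1 = p + 2 by omega]
    | succ k ihk =>
      have h := ihk (p + 1) (fun m hm => ih m (by omega))
      rw [hErec _ _ (by omega) (by omega), Nat.cast_add, show k + 1 + 2 - 1 = k + 2 by omega,
        show p + (k + 1) + 2 = p + 1 + k + 2 by omega, h, taylorMul_cos_succ]
      cases p with
      | zero =>
        rw [show 0 + 1 + k + 2 + 1 - (k + 1 + 2) = 1 by omega, hEn1 _ (by omega),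
          taylorMul_sin_zero_left]
        simp
      | succ p =>
        rw [show p + 1 + 1 + k + 2 + 1 - (k + 1 + 2) = p + 2 by omega,
          taylorMul_sin_succ_left, ← ih (k + 1 + p) (by omega) (k + 1) p rfl,
          show p + 1 + 1 + k + 2 - 1 = k + 1 + p + 2 by omega, sub_add_cancel]

end PowerSeries

section DoubleDescent

variable {α : Type*} [LinearOrder α]

theorem hasDoubleDescent_cons_cons {a b : α} {l : List α} :
    HasDoubleDescent (a :: b :: l) ↔
      (b < a ∧ ∃ c ∈ l.head?, c < b) ∨ HasDoubleDescent (b :: l) := by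
  constructor
  · rintro ⟨_ | i, h, h₁, h₂⟩
    · cases l with
      | nil => simp at h
      | cons c l => exact .inl ⟨h₁, c, rfl, h₂⟩
    · exact .inr ⟨i, by simpa using h, h₁, h₂⟩
  · rintro (⟨h, c, hc, hcb⟩ | ⟨i, h, h₁, h₂⟩)
    · cases l with
      | nil => simp at hc
      | cons d l =>
        obtain rfl : d = c := by simpa using hc
        exact ⟨0, by simp, h, hcb⟩
    · exact ⟨i + 1, by simpa using h, h₁, h₂⟩

theorem not_hasDoubleDescent_nil : ¬ HasDoubleDescent ([] : List α) := by
  rintro ⟨i, h, -⟩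
  simp at h

theorem not_hasDoubleDescent_singleton (a : α) : ¬ HasDoubleDescent [a] := by
  rintro ⟨i, h, -⟩
  simp at h

theorem hasDoubleDescent_cons_of_le {a : α} {l : List α} (h : ∀ c ∈ l.head?, a ≤ c) :
    HasDoubleDescent (a :: l) ↔ HasDoubleDescent l := by
  cases l with
  | nil => simp [not_hasDoubleDescent_nil, not_hasDoubleDescent_singleton]
  | cons b l =>
    have hab : a ≤ b := h b rfl
    simp [hasDoubleDescent_cons_cons, hab.not_gt]

theorem hasDoubleDescent_append_singleton {m : α} :
    ∀ {l : List α}, (∀ a ∈ l, a < m) → (HasDoubleDescent (l ++ [m]) ↔ HasDoubleDescent l)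
  | [], _ => by simp [not_hasDoubleDescent_nil, not_hasDoubleDescent_singleton]
  | [a], h => by
    have ha : a < m := h a (by simp)
    simp [hasDoubleDescent_cons_cons, not_hasDoubleDescent_singleton, ha.not_gt]
  | [a, b], h => by
    have hb : b < m := h b (by simp)
    simp [hasDoubleDescent_cons_cons, not_hasDoubleDescent_singleton, hb.not_gt]
  | a :: b :: c :: l, h => by
    have ih := hasDoubleDescent_append_singleton (l := b :: c :: l) (m := m)
      fun d hd => h d (List.mem_cons_of_mem _ hd)
    simp only [List.cons_append] at ih ⊢
    rw [hasDoubleDescent_cons_cons, ih, hasDoubleDescent_cons_cons (l := c :: l)]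
    simp

end DoubleDescent

section InnerInsertions

variable {α : Type*}

/-- The words obtained by inserting `m` into a word anywhere but at the end. -/
def innerInsertions (m : α) : List α → List (List α)
  | [] => []
  | a :: l => (m :: a :: l) :: (innerInsertions m l).map (List.cons a)

theorem permutations'Aux_eq (m : α) (l : List α) :
    List.permutations'Aux m l = innerInsertions m l ++ [l ++ [m]] := by
  induction l with
  | nil => rfl
  | cons a l ih => simp [innerInsertions, ih]

theorem head?_of_mem_innerInsertions {m c : α} {l l' : List α} (h : l' ∈ innerInsertions m l)
    (hc : c ∈ l'.head?) : c = m ∨ c ∈ l.head? := by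
  cases l with
  | nil => simp [innerInsertions] at h
  | cons a l =>
    simp only [innerInsertions, List.mem_cons, List.mem_map] at h
    rcases h with rfl | ⟨t, -, rfl⟩ <;> simp_all

theorem getLast?_of_mem_innerInsertions {m : α} {l l' : List α}
    (h : l' ∈ innerInsertions m l) : l'.getLast? = l.getLast? := by
  induction l generalizing l' with
  | nil => simp [innerInsertions] at h
  | cons a l ih =>
    simp only [innerInsertions, List.mem_cons, List.mem_map] at h
    rcases h with rfl | ⟨t, ht, rfl⟩
    · simp
    · simp [List.getLast?_cons, ih ht]

end InnerInsertions

section Weight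

open PowerSeries

open scoped Classical in
/-- The sum of `g` over the words of a list that have no double descents. -/
noncomputable def sumNoDoubleDescent {R : Type*} [AddMonoid R] (g : List ℕ → R)
    (L : List (List ℕ)) : R :=
  (L.map fun l => if HasDoubleDescent l then 0 else g l).sum

/-- The weight of a word without double descents, in which every descent `a > b` contributes
the derivative of `sec + tan`, and every entry outside the descents contributes `sec + tan`. -/
noncomputable def weight : List ℕ → ℚ⟦X⟧
  | [] => 1
  | [_] => secAddTan
  | a :: b :: l => if b < a then d⁄dX ℚ secAddTan * weight l else secAddTan * weight (b :: l)

theorem weight_cons_of_le {a : ℕ} {l : List ℕ} (h : ∀ c ∈ l.head?, a ≤ c) :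
    weight (a :: l) = secAddTan * weight l := by
  cases l with
  | nil => simp [weight]
  | cons b l =>
    have hab : a ≤ b := h b rfl
    simp [weight, hab.not_gt]

theorem constantCoeff_weight : ∀ l : List ℕ, constantCoeff (weight l) = 1
  | [] => by simp [weight]
  | [_] => by simp [weight, constantCoeff_secAddTan]
  | a :: b :: l => by
    have h := constantCoeff_weight l
    have h' := constantCoeff_weight (b :: l)
    rw [weight]
    split_ifs <;> simp [h, h', constantCoeff_secAddTan, constantCoeff_derivative_secAddTan]

theorem weight_append_singleton {m : ℕ} :
    ∀ {l : List ℕ}, (∀ a ∈ l, a < m) → weight (l ++ [m]) = secAddTan * weight l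
  | [], _ => by simp [weight]
  | [a], h => by
    have ha : a < m := h a (by simp)
    simp [weight, ha.not_gt]
  | a :: b :: l, h => by
    have h₁ := weight_append_singleton (l := l) (m := m) fun d hd => h d (by simp [hd])
    have h₂ := weight_append_singleton (l := b :: l) (m := m)
      fun d hd => h d (List.mem_cons_of_mem _ hd)
    simp only [List.cons_append] at h₂ ⊢
    rw [weight, weight, h₁, h₂]
    split_ifs <;> ring

theorem sumNoDoubleDescent_weight_innerInsertions {m : ℕ} :
    ∀ {l : List ℕ}, (∀ a ∈ l, a < m) → ¬ HasDoubleDescent l →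
      sumNoDoubleDescent weight (innerInsertions m l) = d⁄dX ℚ (weight l)
  | [], _, _ => by simp [sumNoDoubleDescent, innerInsertions, weight]
  | [a], h, _ => by
    have ha : a < m := h a (by simp)
    simp [sumNoDoubleDescent, innerInsertions, weight, ha, hasDoubleDescent_cons_cons,
      not_hasDoubleDescent_singleton]
  | a :: b :: l, h, hl => by
    have ham : a < m := h a (by simp)
    have hbm : b < m := h b (by simp)
    rw [hasDoubleDescent_cons_cons, not_or] at hl
    by_cases hba : b < a
    · have hbl : ∀ c ∈ l.head?, b ≤ c := fun c hc => not_lt.1 fun hcb => hl.1 ⟨hba, c, hc, hcb⟩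
      have hl' : ¬ HasDoubleDescent l := by rw [← hasDoubleDescent_cons_of_le hbl]; exact hl.2
      have ih := sumNoDoubleDescent_weight_innerInsertions (l := l) (m := m)
        (fun d hd => h d (by simp [hd])) hl'
      have hins : ∀ l' ∈ innerInsertions m l, ∀ c ∈ l'.head?, b ≤ c := fun l' hl' c hc =>
        (head?_of_mem_innerInsertions hl' hc).elim (fun h => h ▸ hbm.le) (hbl c)
      have hmap : sumNoDoubleDescent weight ((innerInsertions m l).map fun l' => a :: b :: l') =
          d⁄dX ℚ secAddTan * sumNoDoubleDescent weight (innerInsertions m l) := by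
        rw [sumNoDoubleDescent, sumNoDoubleDescent, ← List.sum_map_mul_left, List.map_map]
        congr 1
        refine List.map_congr_left fun l' hl' => ?_
        have hb := hins l' hl'
        have : HasDoubleDescent (a :: b :: l') ↔ HasDoubleDescent l' := by
          rw [hasDoubleDescent_cons_cons, hasDoubleDescent_cons_of_le hb, or_iff_right]
          rintro ⟨-, c, hc, hcb⟩
          exact (hb c hc).not_gt hcb
        simp only [Function.comp_apply, weight, if_pos hba, mul_ite, mul_zero]
        classical exact if_congr this rfl rfl
      have h₁ : HasDoubleDescent (m :: a :: b :: l) :=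
        hasDoubleDescent_cons_cons.2 (.inl ⟨ham, b, rfl, hba⟩)
      have h₂ : ¬ HasDoubleDescent (a :: m :: b :: l) := by
        rw [hasDoubleDescent_cons_cons, hasDoubleDescent_cons_cons]
        rintro (⟨h, -⟩ | ⟨-, c, hc, hcb⟩ | h)
        · exact h.not_gt ham
        · exact (hbl c hc).not_gt hcb
        · exact hl.2 h
      have hw : weight (a :: m :: b :: l) =
          secAddTan * (d⁄dX ℚ secAddTan * weight l) := by
        simp [weight, ham.not_gt, hbm]
      rw [ih] at hmap
      simp only [sumNoDoubleDescent] at hmap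
      simp only [sumNoDoubleDescent, innerInsertions, List.map_cons, List.sum_cons, if_pos h₁,
        if_neg h₂, hw, List.map_map] at hmap ⊢
      simp only [Function.comp_def] at hmap ⊢
      rw [hmap]
      simp only [weight, if_pos hba, Derivation.leibniz, smul_eq_mul,
        derivative_derivative_secAddTan]
      ring
    · have hab := not_lt.1 hba
      have ih := sumNoDoubleDescent_weight_innerInsertions (l := b :: l) (m := m)
        (fun d hd => h d (List.mem_cons_of_mem _ hd)) hl.2
      have hmap : sumNoDoubleDescent weight ((innerInsertions m (b :: l)).map (List.cons a)) =
          secAddTan * sumNoDoubleDescent weight (innerInsertions m (b :: l)) := by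
        rw [sumNoDoubleDescent, sumNoDoubleDescent, ← List.sum_map_mul_left, List.map_map]
        congr 1
        refine List.map_congr_left fun l' hl' => ?_
        have ha : ∀ c ∈ l'.head?, a ≤ c := fun c hc =>
          (head?_of_mem_innerInsertions hl' hc).elim (fun h => h ▸ ham.le)
            fun h => (Option.mem_some.1 h) ▸ hab
        simp only [Function.comp_apply, weight_cons_of_le ha, mul_ite, mul_zero]
        classical exact if_congr (hasDoubleDescent_cons_of_le ha) rfl rfl
      have h₁ : ¬ HasDoubleDescent (m :: a :: b :: l) := by
        rw [hasDoubleDescent_cons_cons, hasDoubleDescent_cons_cons]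
        simp [hba, hl.2]
      have hw : weight (m :: a :: b :: l) = d⁄dX ℚ secAddTan * weight (b :: l) := by
        simp [weight, ham]
      rw [ih] at hmap
      rw [innerInsertions]
      simp only [sumNoDoubleDescent] at hmap
      simp only [sumNoDoubleDescent, List.map_cons, List.sum_cons, if_neg h₁, hw, hmap]
      simp only [weight, if_neg hba, Derivation.leibniz, smul_eq_mul]
      ring

end Weight

section SimsunSum

open PowerSeries

theorem perm_of_mem_permutations'Aux {α : Type*} {m : α} {l l' : List α}
    (h : l' ∈ List.permutations'Aux m l) : l'.Perm (m :: l) :=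
  List.mem_permutations'.1 <| List.mem_flatMap.2 ⟨l, List.mem_permutations'.2 (.refl l), h⟩

theorem filter_of_mem_permutations'Aux {α : Type*} {m : α} {p : α → Bool} (hm : p m = false)
    {l l' : List α} (h : l' ∈ List.permutations'Aux m l) : l'.filter p = l.filter p := by
  induction l generalizing l' with
  | nil => simp_all
  | cons a l ih =>
    simp only [List.permutations'Aux, List.mem_cons, List.mem_map] at h
    rcases h with rfl | ⟨t, ht, rfl⟩
    · simp [hm]
    · simp [List.filter_cons, ih ht]

theorem reverse_range'_one_succ (n : ℕ) :
    (List.range' 1 (n + 1)).reverse = (n + 1) :: (List.range' 1 n).reverse := by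
  rw [List.range'_concat, List.reverse_append, one_mul, Nat.add_comm 1 n]
  rfl

theorem mem_permutations'_reverse_range' {n : ℕ} {l : List ℕ} :
    l ∈ List.permutations' (List.range' 1 n).reverse ↔ l.Perm (List.range' 1 n) := by
  rw [List.mem_permutations']
  exact ⟨fun h => h.trans (List.reverse_perm _), fun h => h.trans (List.reverse_perm _).symm⟩

theorem lt_succ_of_perm_range' {n : ℕ} {l : List ℕ} (h : l.Perm (List.range' 1 n)) {a : ℕ}
    (ha : a ∈ l) : a < n + 1 := by
  obtain ⟨i, hi, rfl⟩ := List.mem_range'.1 (h.mem_iff.1 ha)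
  omega

theorem _root_.IsSimsun.not_hasDoubleDescent {n : ℕ} {l : List ℕ} (h : IsSimsun n l) :
    ¬ HasDoubleDescent l := by
  have hlt := fun a (ha : a ∈ l) => lt_succ_of_perm_range' h.1 ha
  rcases Nat.eq_zero_or_pos n with rfl | hn
  · obtain rfl : l = [] := by simpa using h.1
    exact not_hasDoubleDescent_nil
  · have := h.2 n hn le_rfl
    rwa [List.filter_eq_self.2 fun a ha => by simpa using Nat.le_of_lt_succ (hlt a ha)] at this

theorem isSimsun_succ_iff {n : ℕ} {l l' : List ℕ} (hl : l.Perm (List.range' 1 n))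
    (h : l' ∈ List.permutations'Aux (n + 1) l) :
    IsSimsun (n + 1) l' ↔ IsSimsun n l ∧ ¬ HasDoubleDescent l' := by
  have hfilter : ∀ k ≤ n, l'.filter (fun x => decide (x ≤ k)) =
      l.filter (fun x => decide (x ≤ k)) := fun k hk =>
    filter_of_mem_permutations'Aux (by simpa using Nat.lt_succ_of_le hk) h
  have hl' : l'.Perm (List.range' 1 (n + 1)) := by
    refine (perm_of_mem_permutations'Aux h).trans ?_
    rw [List.range'_concat, one_mul, Nat.add_comm 1 n]
    exact (hl.cons _).trans (List.perm_append_singleton _ _).symm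
  constructor
  · refine fun hs => ⟨⟨hl, fun k hk hkn => ?_⟩, hs.not_hasDoubleDescent⟩
    rw [← hfilter k hkn]
    exact hs.2 k hk (by omega)
  · rintro ⟨hs, hdd⟩
    refine ⟨hl', fun k hk hkn => ?_⟩
    rcases Nat.lt_or_eq_of_le hkn with hkn | rfl
    · rw [hfilter k (by omega)]
      exact hs.2 k hk (by omega)
    · rwa [List.filter_eq_self.2 fun a ha => by
        simpa using Nat.le_of_lt_succ (lt_succ_of_perm_range' hl' ha)]

theorem sum_map_flatMap {α β R : Type*} [AddMonoid R] (L : List α) (f : α → List β)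
    (g : β → R) : ((L.flatMap f).map g).sum = (L.map fun a => ((f a).map g).sum).sum := by
  induction L with
  | nil => simp
  | cons a L ih => simp [ih]

open scoped Classical in
/-- The sum of `g` over the Simsun permutations of `[n]`. -/
noncomputable def simsunSum (n : ℕ) (g : List ℕ → ℚ⟦X⟧) : ℚ⟦X⟧ :=
  ((List.permutations' (List.range' 1 n).reverse).map
    fun l => if IsSimsun n l then g l else 0).sum

theorem simsunSum_congr {n : ℕ} {f g : List ℕ → ℚ⟦X⟧} (h : ∀ l, IsSimsun n l → f l = g l) :
    simsunSum n f = simsunSum n g := by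
  rw [simsunSum, simsunSum]
  congr 2
  funext l
  split_ifs with hl
  exacts [h l hl, rfl]

theorem simsunSum_add (n : ℕ) (f g : List ℕ → ℚ⟦X⟧) :
    simsunSum n (fun l => f l + g l) = simsunSum n f + simsunSum n g := by
  rw [simsunSum, simsunSum, simsunSum, ← List.sum_map_add]
  congr 2
  funext l
  split_ifs <;> simp

theorem simsunSum_map {F : Type*} [FunLike F ℚ⟦X⟧ ℚ⟦X⟧] [AddMonoidHomClass F ℚ⟦X⟧ ℚ⟦X⟧]
    (D : F) (n : ℕ) (f : List ℕ → ℚ⟦X⟧) :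
    simsunSum n (fun l => D (f l)) = D (simsunSum n f) := by
  rw [simsunSum, simsunSum, map_list_sum, List.map_map]
  congr 2
  funext l
  simp only [Function.comp_apply]
  split_ifs <;> simp

theorem simsunSum_succ (n : ℕ) (g : List ℕ → ℚ⟦X⟧) :
    simsunSum (n + 1) g = simsunSum n fun l =>
      sumNoDoubleDescent g (innerInsertions (n + 1) l) + g (l ++ [n + 1]) := by
  classical
  rw [simsunSum, simsunSum, reverse_range'_one_succ, List.permutations', sum_map_flatMap]
  congr 1
  refine List.map_congr_left fun l hl => ?_
  rw [mem_permutations'_reverse_range'] at hl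
  split_ifs with hs
  · have hdd : ¬ HasDoubleDescent (l ++ [n + 1]) := by
      rw [hasDoubleDescent_append_singleton fun a ha => lt_succ_of_perm_range' hl ha]
      exact hs.not_hasDoubleDescent
    calc
      _ = sumNoDoubleDescent g (List.permutations'Aux (n + 1) l) := by
        rw [sumNoDoubleDescent]
        congr 1
        refine List.map_congr_left fun l' hl' => ?_
        simp only [isSimsun_succ_iff hl hl', hs, true_and, ite_not]
      _ = _ := by simp [permutations'Aux_eq, sumNoDoubleDescent, hdd]
  · apply List.sum_eq_zero
    simp only [List.mem_map]
    rintro _ ⟨l', hl', rfl⟩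
    simp [isSimsun_succ_iff hl hl', hs]

theorem sumNoDoubleDescent_weight_of_isSimsun {n : ℕ} {l : List ℕ} (hl : IsSimsun n l) :
    sumNoDoubleDescent weight (innerInsertions (n + 1) l) = d⁄dX ℚ (weight l) :=
  sumNoDoubleDescent_weight_innerInsertions (fun _ ha => lt_succ_of_perm_range' hl.1 ha)
    hl.not_hasDoubleDescent

theorem weight_append_of_isSimsun {n : ℕ} {l : List ℕ} (hl : IsSimsun n l) :
    weight (l ++ [n + 1]) = secAddTan * weight l :=
  weight_append_singleton fun _ ha => lt_succ_of_perm_range' hl.1 ha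

theorem simsunSum_weight_mul (n : ℕ) :
    simsunSum n weight * d⁄dX ℚ secAddTan = (d⁄dX ℚ)^[n + 1] secAddTan := by
  induction n with
  | zero =>
    have : IsSimsun 0 [] := ⟨by simp, fun k hk hk' => by omega⟩
    simp [simsunSum, this, weight]
  | succ n ih =>
    have hmul := simsunSum_map (AddMonoidHom.mulLeft secAddTan) n weight
    simp only [AddMonoidHom.coe_mulLeft] at hmul
    rw [simsunSum_succ, simsunSum_congr (g := fun l => d⁄dX ℚ (weight l) + secAddTan * weight l)
      fun l hl => by rw [sumNoDoubleDescent_weight_of_isSimsun hl, weight_append_of_isSimsun hl],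
      simsunSum_add, simsunSum_map, hmul, Function.iterate_succ_apply', ← ih,
      Derivation.leibniz, derivative_derivative_secAddTan]
    simp only [smul_eq_mul]
    ring

open scoped Classical in
/-- The total weight of the Simsun permutations of `[n]` with last entry `k`. -/
noncomputable def lastWeightSum (n k : ℕ) : ℚ⟦X⟧ :=
  simsunSum n fun l => if l.getLast? = some k then weight l else 0

theorem sumNoDoubleDescent_getLast?_innerInsertions (m k : ℕ) (l : List ℕ) :
    sumNoDoubleDescent (fun l' => if l'.getLast? = some k then weight l' else 0)
      (innerInsertions m l) =
        if l.getLast? = some k then sumNoDoubleDescent weight (innerInsertions m l) else 0 := by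
  have h : ∀ l' ∈ innerInsertions m l, l'.getLast? = l.getLast? :=
    fun l' => getLast?_of_mem_innerInsertions
  split_ifs with hk
  · rw [sumNoDoubleDescent, sumNoDoubleDescent]
    congr 1
    exact List.map_congr_left fun l' hl' => by simp [h l' hl', hk]
  · apply List.sum_eq_zero
    simp only [List.mem_map]
    rintro _ ⟨l', hl', rfl⟩
    simp [h l' hl', hk]

theorem lastWeightSum_succ_self (n : ℕ) :
    lastWeightSum (n + 1) (n + 1) = cos ℚ * (d⁄dX ℚ)^[n + 1] secAddTan := by
  have hmul := simsunSum_map (AddMonoidHom.mulLeft secAddTan) n weight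
  simp only [AddMonoidHom.coe_mulLeft] at hmul
  rw [lastWeightSum, simsunSum_succ, ← simsunSum_weight_mul, mul_left_comm,
    cos_mul_derivative_secAddTan, mul_comm, ← hmul]
  refine simsunSum_congr fun l hl => ?_
  have hlast : l.getLast? ≠ some (n + 1) := fun h =>
    (lt_succ_of_perm_range' hl.1 (List.mem_of_getLast? h)).ne rfl
  rw [sumNoDoubleDescent_getLast?_innerInsertions, if_neg hlast, zero_add,
    if_pos (by simp), weight_append_of_isSimsun hl]

theorem lastWeightSum_succ {n k : ℕ} (hk : k ≤ n) :
    lastWeightSum (n + 1) k = d⁄dX ℚ (lastWeightSum n k) := by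
  rw [lastWeightSum, lastWeightSum, simsunSum_succ, ← simsunSum_map]
  refine simsunSum_congr fun l hl => ?_
  have hne : n + 1 ≠ k := by omega
  rw [sumNoDoubleDescent_getLast?_innerInsertions, sumNoDoubleDescent_weight_of_isSimsun hl,
    if_neg (by simpa using hne : (l ++ [n + 1]).getLast? ≠ some k), add_zero]
  split_ifs <;> simp

theorem lastWeightSum_eq (p k : ℕ) :
    lastWeightSum (p + (k + 1)) (k + 1) =
      (d⁄dX ℚ)^[p] (cos ℚ * (d⁄dX ℚ)^[k + 1] secAddTan) := by
  induction p with
  | zero => rw [zero_add, lastWeightSum_succ_self, Function.iterate_zero_apply]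
  | succ p ih =>
    rw [add_right_comm, lastWeightSum_succ (by omega), ih, Function.iterate_succ_apply' _ p]

theorem constantCoeff_lastWeightSum (n k : ℕ) :
    constantCoeff (lastWeightSum n k) =
      Nat.card {l : List ℕ // IsSimsun n l ∧ l.getLast? = some k} := by
  classical
  have hnodup : (List.permutations' (List.range' 1 n).reverse).Nodup :=
    (List.permutations_perm_permutations' _).nodup_iff.1
      (List.nodup_permutations _ (List.nodup_reverse.2 List.nodup_range'))
  have hsum : ∀ L : List (List ℕ),
      (L.map fun l => if IsSimsun n l ∧ l.getLast? = some k then (1 : ℚ) else 0).sum =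
        (L.filter fun l => IsSimsun n l ∧ l.getLast? = some k).length := by
    intro L
    induction L with
    | nil => simp
    | cons l L ih =>
      rw [List.map_cons, List.sum_cons, ih, List.filter_cons]
      by_cases h : IsSimsun n l ∧ l.getLast? = some k
      · simp [h, add_comm]
      · simp [h]
  rw [Nat.subtype_card
    ((List.permutations' (List.range' 1 n).reverse).filter
      fun l => IsSimsun n l ∧ l.getLast? = some k).toFinset, List.toFinset_card_of_nodup
        (hnodup.filter _), ← hsum, lastWeightSum, simsunSum, map_list_sum, List.map_map]
  · congr 2
    funext l
    simp only [Function.comp_apply, ite_and]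
    split_ifs <;> simp [constantCoeff_weight]
  · intro l
    simp only [List.mem_toFinset, List.mem_filter, mem_permutations'_reverse_range',
      decide_eq_true_eq, and_iff_right_iff_imp]
    exact fun h => h.1.1

end SimsunSum

end Simsun

/-- For `n ≥ 2` and `2 ≤ k ≤ n`, the number of Simsun permutations of `[n-1]` with
last entry `k-1` equals the Entringer number `E n k`. -/
theorem card_simsun_last_eq_entringer
    (E : ℕ → ℕ → ℕ)
    (hE11 : E 1 1 = 1)
    (hEn1 : ∀ n : ℕ, 2 ≤ n → E n 1 = 0)
    (hErec : ∀ n k : ℕ, 2 ≤ k → k ≤ n → E n k = E n (k - 1) + E (n - 1) (n + 1 - k))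
    (n k : ℕ) (hn : 2 ≤ n) (hk : 2 ≤ k) (hkn : k ≤ n) :
    Nat.card {l : List ℕ // IsSimsun (n - 1) l ∧ l.getLast? = some (k - 1)} = E n k := by
  obtain ⟨k, rfl⟩ := Nat.exists_eq_add_of_le' hk
  obtain ⟨p, rfl⟩ := Nat.exists_eq_add_of_le' hkn
  have h := Simsun.constantCoeff_lastWeightSum (p + (k + 1)) (k + 1)
  rw [Simsun.lastWeightSum_eq] at h
  exact_mod_cast h.symm.trans (Simsun.entringer_eq_taylorMul E hE11 hEn1 hErec p k).symm
end
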